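/- Let n ≥ 2, let Ω ⊆ ℝⁿ be a nonempty open convex set of finite diameter D = sup_{x,y∈Ω} ‖x−y‖, let ρ : Ω → ℝ be smooth and convex, and let μ be the measure on Ω with density e^{−ρ} with respect to Lebesgue measure. Then for every C¹ function f : Ω → ℝ with f ∈ L¹(μ) ∩ L²(μ) and ∫_Ω f dμ = 0, one has (π²/D²)·∫_Ω f² dμ ≤ ∫_Ω ‖∇f‖² dμ. (Payne–Weinberger/Yang–Zhong Poincaré inequality for convex domains with log-concave weight; the classical Payne–Weinberger inequality is the case ρ ≡ 0, μ the Lebesgue measure on a bounded open convex set.) -/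

import Mathlib

open MeasureTheory
open scoped ENNReal

namespace PW
section
open Set Filter Topology


lemma dirichlet_core {a b κ : ℝ} (hab : a < b) (hκ : 0 ≤ κ) (hκb : κ * (b - a) < Real.pi)
    (φ φ' φ'' W W' : ℝ → ℝ) (h1 : ∀ t, HasDerivAt φ (φ' t) t) (h2 : ∀ t, HasDerivAt φ' (φ'' t) t)
    (h3 : ∀ t ∈ Icc a b, 0 ≤ φ'' t) (hW : ∀ t, HasDerivAt W (W' t) t) (hW' : Continuous W')
    (hWa : W a = 0) (hWb : W b = 0) :
    κ ^ 2 * ∫ t in a..b, Real.exp (φ t) * W t ^ 2 ≤ ∫ t in a..b, Real.exp (φ t) * W' t ^ 2 := by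
  have cφ : Continuous φ := continuous_iff_continuousAt.2 fun t => (h1 t).continuousAt
  have cφ' : Continuous φ' := continuous_iff_continuousAt.2 fun t => (h2 t).continuousAt
  have cW : Continuous W := continuous_iff_continuousAt.2 fun t => (hW t).continuousAt
  set m := (a + b) / 2 with hm
  have hcos : ∀ t ∈ Icc a b, 0 < Real.cos (κ * (t - m)) := by
    intro t ht
    apply Real.cos_pos_of_mem_Ioo
    have e1 : κ * (t - m) ≤ κ * ((b - a) / 2) := by
      apply mul_le_mul_of_nonneg_left _ hκ; rw [hm]; linarith [ht.2]
    have e2 : κ * (-((b - a) / 2)) ≤ κ * (t - m) := by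
      apply mul_le_mul_of_nonneg_left _ hκ; rw [hm]; linarith [ht.1]
    constructor <;> linarith
  let q : ℝ → ℝ := fun t => - φ' t / 2 - κ * (Real.sin (κ * (t - m)) / Real.cos (κ * (t - m)))
  have hq : ∀ t ∈ Icc a b, HasDerivAt q (- φ'' t / 2 - κ ^ 2 * (1 + (Real.sin (κ * (t - m)) / Real.cos (κ * (t - m)))^2)) t := by
    intro t ht
    have hc := (hcos t ht).ne'
    have hl : HasDerivAt (fun t => κ * (t - m)) κ t := by
      simpa using ((hasDerivAt_id t).sub_const m).const_mul κ
    have := ((h2 t).neg.div_const 2).sub (((hl.sin).div hl.cos hc).const_mul κ)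
    refine this.congr_deriv ?_
    have hs := Real.sin_sq_add_cos_sq (κ * (t - m))
    field_simp
    ring
  have key := intervalIntegral.sub_le_integral_of_hasDeriv_right_of_le (a := a) (b := b)
    (g := fun t => Real.exp (φ t) * q t * W t ^ 2)
    (g' := fun t => (Real.exp (φ t) * φ' t * q t + Real.exp (φ t) * (- φ'' t / 2 - κ ^ 2 * (1 + (Real.sin (κ * (t - m)) / Real.cos (κ * (t - m)))^2))) * W t ^ 2 + Real.exp (φ t) * q t * (2 * W t * W' t))
    (φ := fun t => Real.exp (φ t) * W' t ^ 2 - κ ^ 2 * (Real.exp (φ t) * W t ^ 2)) hab.le ?_ ?_ ?_ ?_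
  · rw [intervalIntegral.integral_sub, intervalIntegral.integral_const_mul] at key
    · simp only [hWa, hWb] at key
      norm_num at key
      linarith
    · exact (by fun_prop : Continuous _).intervalIntegrable _ _
    · exact (by fun_prop : Continuous _).intervalIntegrable _ _
  · intro t ht
    have := (hq t ht).continuousAt.continuousWithinAt (s := Icc a b)
    exact (cφ.rexp.continuousWithinAt.mul this).mul (cW.pow 2).continuousWithinAt
  · intro t ht
    have ht' := Ioo_subset_Icc_self ht
    refine HasDerivAt.hasDerivWithinAt ?_
    refine ((((h1 t).exp).mul (hq t ht')).mul ((hW t).pow 2)).congr_deriv ?_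
    simp
  · exact (by fun_prop : Continuous _).integrableOn_Icc
  · intro t ht
    have ht' := Ioo_subset_Icc_self ht
    have h3' := h3 t ht'
    have hE := Real.exp_pos (φ t)
    simp only [q]
    set E := Real.exp (φ t)
    set T := Real.sin (κ * (t - m)) / Real.cos (κ * (t - m))
    have i1 := mul_nonneg hE.le (sq_nonneg (W' t - (- φ' t / 2 - κ * T) * W t))
    have i2 := mul_nonneg hE.le (mul_nonneg h3' (sq_nonneg (W t)))
    have i3 := mul_nonneg hE.le (sq_nonneg (φ' t * W t))
    nlinarith [i1, i2, i3]

lemma poincare_smooth {a b κ : ℝ} (hab : a < b) (hκ : 0 < κ) (hκb : κ * (b - a) < Real.pi)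
    (φ φ' φ'' G G' : ℝ → ℝ) (h1 : ∀ t, HasDerivAt φ (φ' t) t) (h2 : ∀ t, HasDerivAt φ' (φ'' t) t)
    (h3 : ∀ t ∈ Icc a b, 0 ≤ φ'' t) (hG : Continuous G) (hG' : Continuous G')
    (hGd : ∀ t ∈ Ioo a b, HasDerivAt G (G' t) t)
    (h0 : ∫ t in a..b, G t * Real.exp (- φ t) = 0) :
    κ ^ 2 * ∫ t in a..b, G t ^ 2 * Real.exp (- φ t) ≤ ∫ t in a..b, G' t ^ 2 * Real.exp (- φ t) := by
  have cφ : Continuous φ := continuous_iff_continuousAt.2 fun t => (h1 t).continuousAt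
  set W : ℝ → ℝ := fun t => ∫ s in a..t, G s * Real.exp (- φ s) with hWdef
  have cW' : Continuous fun s => G s * Real.exp (- φ s) := by fun_prop
  have hW : ∀ t, HasDerivAt W (G t * Real.exp (- φ t)) t := fun t =>
    intervalIntegral.integral_hasDerivAt_right (cW'.intervalIntegrable _ _)
      (cW'.stronglyMeasurableAtFilter _ _) cW'.continuousAt
  have cW : Continuous W := continuous_iff_continuousAt.2 fun t => (hW t).continuousAt
  have hD := dirichlet_core hab hκ.le hκb φ φ' φ'' W _ h1 h2 h3 hW cW' (by simp [hWdef]) h0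
  have ibp := intervalIntegral.integral_mul_deriv_eq_deriv_mul_of_hasDerivAt (a := a) (b := b) (u := W) (v := G)
    (u' := fun t => G t * Real.exp (- φ t)) (v' := G') cW.continuousOn hG.continuousOn
    (fun t _ => hW t) (fun t ht => hGd t (by rwa [min_eq_left hab.le, max_eq_right hab.le] at ht)) (cW'.intervalIntegrable _ _) (hG'.intervalIntegrable _ _)
  have e1 : W a = 0 := by simp [hWdef]
  have e2 : W b = 0 := h0
  rw [e1, e2] at ibp
  have e3 : (fun t => Real.exp (φ t) * (G t * Real.exp (- φ t)) ^ 2) = fun t => G t ^ 2 * Real.exp (- φ t) := by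
    ext t; rw [Real.exp_neg]; field_simp
  rw [e3] at hD
  have e4 : (∫ t in a..b, G t * Real.exp (- φ t) * G t) = ∫ t in a..b, G t ^ 2 * Real.exp (- φ t) := by
    congr 1; ext t; ring
  rw [e4] at ibp
  have young : (∫ t in a..b, - (W t * G' t) * κ^2 * 2) ≤ ∫ t in a..b, (κ^2 * (κ ^ 2 * (Real.exp (φ t) * W t ^ 2)) + G' t ^ 2 * Real.exp (- φ t)) := by
    apply intervalIntegral.integral_mono_on hab.le
    · exact (by fun_prop : Continuous _).intervalIntegrable _ _
    · exact (by fun_prop : Continuous _).intervalIntegrable _ _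
    · intro t _
      have hE := Real.exp_pos (φ t)
      rw [Real.exp_neg]
      set E := Real.exp (φ t)
      have : 0 ≤ E * (κ^2 * W t + G' t * E⁻¹)^2 := by positivity
      have h5 : E * (κ^2 * W t + G' t * E⁻¹)^2 = κ^2 * (κ ^ 2 * (E * W t ^ 2)) + G' t ^ 2 * E⁻¹ + W t * G' t * κ^2 * 2 := by
        field_simp
        ring
      linarith
  rw [intervalIntegral.integral_add, intervalIntegral.integral_const_mul, intervalIntegral.integral_const_mul, intervalIntegral.integral_mul_const, intervalIntegral.integral_mul_const, intervalIntegral.integral_neg] at young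
  · have := mul_le_mul_of_nonneg_left hD (sq_nonneg κ)
    rw [ibp] at young
    linarith
  · exact (by fun_prop : Continuous _).intervalIntegrable _ _
  · exact (by fun_prop : Continuous _).intervalIntegrable _ _


lemma poincare_smooth_var {a b κ : ℝ} (hab : a < b) (hκ : 0 < κ) (hκb : κ * (b - a) < Real.pi)
    (φ φ' φ'' G G' : ℝ → ℝ) (h1 : ∀ t, HasDerivAt φ (φ' t) t) (h2 : ∀ t, HasDerivAt φ' (φ'' t) t)
    (h3 : ∀ t ∈ Icc a b, 0 ≤ φ'' t) (hG : Continuous G) (hG' : Continuous G')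
    (hGd : ∀ t ∈ Ioo a b, HasDerivAt G (G' t) t) :
    κ ^ 2 * ((∫ t in a..b, G t ^ 2 * Real.exp (- φ t)) * (∫ t in a..b, Real.exp (- φ t))
      - (∫ t in a..b, G t * Real.exp (- φ t)) ^ 2) ≤
      (∫ t in a..b, G' t ^ 2 * Real.exp (- φ t)) * (∫ t in a..b, Real.exp (- φ t)) := by
  have cφ : Continuous φ := continuous_iff_continuousAt.2 fun t => (h1 t).continuousAt
  have hM : 0 < ∫ t in a..b, Real.exp (- φ t) :=
    intervalIntegral.intervalIntegral_pos_of_pos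
      ((by fun_prop : Continuous fun t => Real.exp (- φ t)).intervalIntegrable _ _) (fun t => Real.exp_pos _) hab
  set M := ∫ t in a..b, Real.exp (- φ t) with hMdef
  set A := ∫ t in a..b, G t * Real.exp (- φ t) with hA
  set B := ∫ t in a..b, G t ^ 2 * Real.exp (- φ t) with hB
  have ii : ∀ F : ℝ → ℝ, Continuous F → IntervalIntegrable F volume a b := fun F h => h.intervalIntegrable _ _
  have h0 : ∫ t in a..b, (G t - A / M) * Real.exp (- φ t) = 0 := by
    have : (fun t => (G t - A / M) * Real.exp (- φ t)) = fun t => G t * Real.exp (- φ t) - A / M * Real.exp (- φ t) := by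
      ext t; ring
    rw [this, intervalIntegral.integral_sub (ii _ (by fun_prop)) (ii _ (by fun_prop)), intervalIntegral.integral_const_mul, ← hMdef, ← hA]
    field_simp; ring
  have := poincare_smooth hab hκ hκb φ φ' φ'' (fun t => G t - A / M) G' h1 h2 h3 (by fun_prop) hG'
    (fun t ht => (hGd t ht).sub_const _) h0
  have e : ∫ t in a..b, (G t - A / M) ^ 2 * Real.exp (- φ t) = B - A ^ 2 / M := by
    have : (fun t => (G t - A / M) ^ 2 * Real.exp (- φ t)) = fun t => G t ^ 2 * Real.exp (- φ t) - 2 * (A / M) * (G t * Real.exp (- φ t)) + (A / M) ^ 2 * Real.exp (- φ t) := by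
      ext t; ring
    rw [this, intervalIntegral.integral_add (ii _ (by fun_prop)) (ii _ (by fun_prop)), intervalIntegral.integral_sub (ii _ (by fun_prop)) (ii _ (by fun_prop)), intervalIntegral.integral_const_mul, intervalIntegral.integral_const_mul, ← hMdef, ← hA, ← hB]
    field_simp; ring
  rw [e] at this
  calc _ = κ ^ 2 * (B - A ^ 2 / M) * M := by field_simp
    _ ≤ _ := mul_le_mul_of_nonneg_right this hM.le

lemma steklov (φ : ℝ → ℝ) (hφ : Continuous φ) (ε : ℝ) (hε : 0 < ε) :
    ∃ S : ℝ → ℝ, (∀ t, HasDerivAt S (ε⁻¹ * (φ (t + ε) - φ t)) t) ∧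
      ∀ t, ∃ s ∈ Icc t (t + ε), S t = φ s := by
  set Φ : ℝ → ℝ := fun t => ∫ s in (0:ℝ)..t, φ s
  have hΦ : ∀ t, HasDerivAt Φ (φ t) t := fun t =>
    intervalIntegral.integral_hasDerivAt_right (hφ.intervalIntegrable _ _)
      (hφ.stronglyMeasurableAtFilter _ _) hφ.continuousAt
  have cΦ : Continuous Φ := continuous_iff_continuousAt.2 fun t => (hΦ t).continuousAt
  refine ⟨fun t => ε⁻¹ * (Φ (t + ε) - Φ t), fun t => ?_, fun t => ?_⟩
  · exact (((hΦ (t + ε)).comp_add_const t ε).sub (hΦ t)).const_mul _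
  · obtain ⟨c, hc, h⟩ := exists_hasDerivAt_eq_slope Φ φ (by linarith : t < t + ε) cΦ.continuousOn (fun x _ => hΦ x)
    refine ⟨c, Ioo_subset_Icc_self hc, ?_⟩
    rw [h, add_sub_cancel_left, div_eq_inv_mul]

lemma steklov2 (φ : ℝ → ℝ) (hφ : Continuous φ) (ε : ℝ) (hε : 0 < ε) :
    ∃ S S' S'' : ℝ → ℝ, (∀ t, HasDerivAt S (S' t) t) ∧ (∀ t, HasDerivAt S' (S'' t) t) ∧
      (∀ t, 0 ≤ φ (t + 2 * ε) - 2 * φ (t + ε) + φ t → 0 ≤ S'' t) ∧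
      ∀ t, ∃ s ∈ Icc t (t + 2 * ε), S t = φ s := by
  obtain ⟨S, hS, hS2⟩ := steklov φ hφ ε hε
  have cS : Continuous S := continuous_iff_continuousAt.2 fun t => (hS t).continuousAt
  obtain ⟨T, hT, hT2⟩ := steklov S cS ε hε
  refine ⟨T, _, fun t => ε⁻¹ * (ε⁻¹ * (φ (t + ε + ε) - φ (t + ε)) - ε⁻¹ * (φ (t + ε) - φ t)), hT, fun t => ?_, fun t ht => ?_, fun t => ?_⟩
  · exact (((hS (t + ε)).comp_add_const t ε).sub (hS t)).const_mul _
  · beta_reduce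
    rw [← mul_sub, show t + ε + ε = t + 2 * ε by ring]
    have : 0 ≤ φ (t + 2 * ε) - φ (t + ε) - (φ (t + ε) - φ t) := by linarith
    positivity
  · obtain ⟨s, hs, h⟩ := hT2 t
    obtain ⟨r, hr, h'⟩ := hS2 s
    exact ⟨r, ⟨hs.1.trans hr.1, by linarith [hr.2, hs.2]⟩, h.trans h'⟩

lemma poincare_convex {a b c κ : ℝ} (hab : a < b) (hbc : b < c) (hκ : 0 < κ) (hκb : κ * (b - a) < Real.pi)
    (φ G G' : ℝ → ℝ) (hφ : Continuous φ) (hconv : ConvexOn ℝ (Icc a c) φ) (hG : Continuous G) (hG' : Continuous G')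
    (hGd : ∀ t ∈ Ioo a b, HasDerivAt G (G' t) t) :
    κ ^ 2 * ((∫ t in a..b, G t ^ 2 * Real.exp (- φ t)) * (∫ t in a..b, Real.exp (- φ t))
      - (∫ t in a..b, G t * Real.exp (- φ t)) ^ 2) ≤
      (∫ t in a..b, G' t ^ 2 * Real.exp (- φ t)) * (∫ t in a..b, Real.exp (- φ t)) := by
  set ε : ℕ → ℝ := fun k => (c - b) / 2 / ((k : ℝ) + 1) with hεdef
  have hε : ∀ k, 0 < ε k := fun k => by have : 0 < c - b := by linarith
                                        positivity
  have hε2 : ∀ k, ε k ≤ (c - b) / 2 := fun k => by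
    apply div_le_self (by linarith); linarith [(Nat.cast_nonneg k : (0:ℝ) ≤ k)]
  have hε0 : Tendsto ε atTop (𝓝 0) := by
    have := (tendsto_one_div_add_atTop_nhds_zero_nat (𝕜 := ℝ)).const_mul ((c - b) / 2)
    simpa [hεdef, div_eq_mul_inv] using this
  choose S S' S'' h1 h2 h3 h4 using fun k => steklov2 φ hφ (ε k) (hε k)
  choose s hs hSs using h4
  have hlim : ∀ t, Tendsto (fun k => S k t) atTop (𝓝 (φ t)) := by
    intro t
    have : Tendsto (fun k => s k t) atTop (𝓝 t) := by
      refine tendsto_of_tendsto_of_tendsto_of_le_of_le tendsto_const_nhds (h := fun k => t + 2 * ε k) ?_ (fun k => (hs k t).1) (fun k => (hs k t).2)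
      simpa using (hε0.const_mul 2).const_add t
    simp_rw [hSs]
    exact (hφ.tendsto t).comp this
  have cS : ∀ k, Continuous (S k) := fun k => continuous_iff_continuousAt.2 fun t => (h1 k t).continuousAt
  obtain ⟨C, hC⟩ := (isCompact_Icc (a := a) (b := c)).exists_bound_of_continuousOn hφ.continuousOn
  have hI : ∀ F : ℝ → ℝ, Continuous F → Tendsto (fun k => ∫ t in a..b, F t * Real.exp (- S k t)) atTop
      (𝓝 (∫ t in a..b, F t * Real.exp (- φ t))) := by
    intro F hF
    apply intervalIntegral.tendsto_integral_filter_of_dominated_convergence (fun t => |F t| * Real.exp C)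
    · refine Eventually.of_forall fun k => ?_
      have := cS k
      exact (by fun_prop : Continuous _).aestronglyMeasurable
    · refine Eventually.of_forall fun k => Eventually.of_forall fun t ht => ?_
      rw [uIoc_of_le hab.le] at ht
      rw [norm_mul, Real.norm_eq_abs, Real.norm_eq_abs, Real.abs_exp]
      gcongr
      rw [hSs]
      have := hC (s k t) ⟨ht.1.le.trans (hs k t).1, by linarith [(hs k t).2, ht.2, hε2 k]⟩
      rw [Real.norm_eq_abs] at this
      linarith [neg_le_abs (φ (s k t))]
    · exact (by fun_prop : Continuous _).intervalIntegrable _ _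
    · refine Eventually.of_forall fun t ht => ?_
      exact ((hlim t).neg.rexp).const_mul _
  have i0 := hI (fun _ => 1) continuous_const
  simp only [one_mul] at i0
  have i1 := hI G hG
  have i2 := hI (fun t => G t ^ 2) (by fun_prop)
  have i3 := hI (fun t => G' t ^ 2) (by fun_prop)
  refine le_of_tendsto_of_tendsto' (((i2.mul i0).sub (i1.pow 2)).const_mul (κ ^ 2)) (i3.mul i0) fun k => ?_
  refine poincare_smooth_var hab hκ hκb (S k) (S' k) (S'' k) G G' (h1 k) (h2 k) ?_ hG hG' hGd
  intro t ht
  apply h3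
  have e := hε k
  have e2 := hε2 k
  have := hconv.2 (show t ∈ Icc a c from ⟨ht.1, by linarith [ht.2]⟩) (show t + 2 * ε k ∈ Icc a c from ⟨by linarith [ht.1], by linarith [ht.2]⟩) (by norm_num : (0:ℝ) ≤ 1 / 2) (by norm_num : (0:ℝ) ≤ 1 / 2) (by norm_num)
  simp only [smul_eq_mul] at this
  rw [show 1 / 2 * t + 1 / 2 * (t + 2 * ε k) = t + ε k by ring] at this
  linarith


lemma poincare_logconcave {α β κ : ℝ} (hκ : 0 < κ) (hκb : κ * (β - α) ≤ Real.pi)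
    (p G G' : ℝ → ℝ) (hp0 : ∀ t, 0 ≤ p t)
    (hlc : ∀ x y s, 0 < s → s < 1 → p x ^ (1 - s) * p y ^ s ≤ p ((1 - s) * x + s * y))
    (hpi : Integrable p) (hsupp : ∀ t, p t ≠ 0 → t ∈ Icc α β)
    (hG : Continuous G) (hG' : Continuous G') (C : ℝ) (hGb : ∀ t, |G t| ≤ C) (hGb' : ∀ t, |G' t| ≤ C)
    (hGd : ∀ t ∈ Ioo α β, HasDerivAt G (G' t) t) :
    κ ^ 2 * ((∫ t, G t ^ 2 * p t) * (∫ t, p t) - (∫ t, G t * p t) ^ 2) ≤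
      (∫ t, G' t ^ 2 * p t) * (∫ t, p t) := by
  set S : Set ℝ := {t | 0 < p t} with hS
  have hSsub : S ⊆ Icc α β := fun t ht => hsupp t (ne_of_gt ht)
  have hSconv : Convex ℝ S := by
    intro x hx y hy u v hu hv huv
    rcases hu.eq_or_lt with rfl | hu
    · simp at huv; subst huv; simpa using hy
    rcases hv.eq_or_lt with rfl | hv
    · simp at huv; subst huv; simpa using hx
    have : u = 1 - v := by linarith
    subst this
    refine lt_of_lt_of_le ?_ (hlc x y v hv (by linarith))
    exact mul_pos (Real.rpow_pos_of_pos hx _) (Real.rpow_pos_of_pos hy _)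
  have hzero : ∀ t, t ∉ S → p t = 0 := fun t ht => le_antisymm (not_lt.1 ht) (hp0 t)
  have hFi : ∀ F : ℝ → ℝ, Continuous F → (∃ K, ∀ t, |F t| ≤ K) → Integrable (fun t => F t * p t) := by
    rintro F hF ⟨K, hK⟩
    exact hpi.bdd_mul (c := K) hF.aestronglyMeasurable (Eventually.of_forall hK)
  have hC : 0 ≤ C := (abs_nonneg _).trans (hGb 0)
  by_cases hne : S.Nonempty
  swap
  · have : ∀ t, p t = 0 := fun t => hzero t (fun h => hne ⟨t, h⟩)
    simp [this]
  have hbb : BddBelow S := ⟨α, fun t ht => (hSsub ht).1⟩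
  have hba : BddAbove S := ⟨β, fun t ht => (hSsub ht).2⟩
  set A := sInf S with hA
  set B := sSup S with hB
  have hin : Ioo A B ⊆ S := IsConnected.Ioo_csInf_csSup_subset ⟨hne, hSconv.isPreconnected⟩ hbb hba
  have hout : S ⊆ Icc A B := subset_Icc_csInf_csSup hbb hba
  have hαA : α ≤ A := le_csInf hne fun t ht => (hSsub ht).1
  have hBβ : B ≤ β := csSup_le hne fun t ht => (hSsub ht).2
  have hres : ∀ F : ℝ → ℝ, ∫ t, F t * p t = ∫ t in Ioo A B, F t * p t := by
    intro F
    rw [← integral_Icc_eq_integral_Ioo]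
    refine (setIntegral_eq_integral_of_forall_compl_eq_zero fun t ht => ?_).symm
    rw [hzero t fun h => ht (hout h), mul_zero]
  by_cases hAB : A < B
  swap
  · have : Ioo A B = ∅ := Ioo_eq_empty hAB
    have h1 := hres (fun _ => 1)
    simp only [one_mul] at h1
    rw [h1, hres, hres, hres, this]
    simp
  have hφc : ConvexOn ℝ (Ioo A B) (fun t => - Real.log (p t)) := by
    refine ⟨convex_Ioo A B, ?_⟩
    intro x hx y hy u v hu hv huv
    rcases hu.eq_or_lt with rfl | hu
    · simp at huv; subst huv; simp
    rcases hv.eq_or_lt with rfl | hv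
    · simp at huv; subst huv; simp
    have : u = 1 - v := by linarith
    subst this
    have px : 0 < p x := hin hx
    have py : 0 < p y := hin hy
    have h := Real.log_le_log (mul_pos (Real.rpow_pos_of_pos px _) (Real.rpow_pos_of_pos py _)) (hlc x y v hv (by linarith))
    rw [Real.log_mul (Real.rpow_pos_of_pos px _).ne' (Real.rpow_pos_of_pos py _).ne', Real.log_rpow px, Real.log_rpow py] at h
    simp only [smul_eq_mul]
    linarith
  have hφcont : ContinuousOn (fun t => - Real.log (p t)) (Ioo A B) := hφc.continuousOn isOpen_Ioo
  set r : ℕ → ℝ := fun k => (B - A) / 3 / ((k : ℝ) + 1) with hrdef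
  have hr : ∀ k, 0 < r k := fun k => by have : 0 < B - A := by linarith
                                        positivity
  have hr2 : ∀ k, r k ≤ (B - A) / 3 := fun k => by
    apply div_le_self (by linarith); linarith [(Nat.cast_nonneg k : (0:ℝ) ≤ k)]
  have hr0 : Tendsto r atTop (𝓝 0) := by
    have := (tendsto_one_div_add_atTop_nhds_zero_nat (𝕜 := ℝ)).const_mul ((B - A) / 3)
    simpa [hrdef, div_eq_mul_inv] using this
  have cov : AECover (volume.restrict (Ioo A B)) atTop (fun k => Icc (A + r k) (B - r k)) := by
    apply aecover_Ioo_of_Icc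
    · simpa using hr0.const_add A
    · simpa using hr0.const_sub B
  have hI : ∀ F : ℝ → ℝ, Continuous F → (∃ K, ∀ t, |F t| ≤ K) →
      Tendsto (fun k => ∫ t in (A + r k)..(B - r k), F t * p t) atTop (𝓝 (∫ t, F t * p t)) := by
    intro F hF hK
    rw [hres]
    have := cov.integral_tendsto_of_countably_generated (hFi F hF hK).integrableOn
    refine this.congr fun k => ?_
    rw [intervalIntegral.integral_of_le (by linarith [hr k, hr2 k]), Measure.restrict_restrict measurableSet_Icc, integral_Icc_eq_integral_Ioc.symm]
    congr 2
    apply inter_eq_left.2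
    intro t ht
    exact ⟨by linarith [ht.1, hr k], by linarith [ht.2, hr k]⟩
  have i0 := hI (fun _ => 1) continuous_const ⟨1, by simp⟩
  simp only [one_mul] at i0
  have i1 := hI G hG ⟨C, hGb⟩
  have sqb : ∀ x : ℝ, |x| ≤ C → |x ^ 2| ≤ C ^ 2 := fun x hx => by
    rw [abs_pow]; gcongr
  have i2 := hI (fun t => G t ^ 2) (by fun_prop) ⟨C ^ 2, fun t => sqb _ (hGb t)⟩
  have i3 := hI (fun t => G' t ^ 2) (by fun_prop) ⟨C ^ 2, fun t => sqb _ (hGb' t)⟩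
  refine le_of_tendsto_of_tendsto' (((i2.mul i0).sub (i1.pow 2)).const_mul (κ ^ 2)) (i3.mul i0) fun k => ?_
  have rk := hr k
  have rk2 := hr2 k
  have hle : A + r k ≤ B - r k / 2 := by linarith
  have hsub : Icc (A + r k) (B - r k / 2) ⊆ Ioo A B := fun t ht => ⟨by linarith [ht.1], by linarith [ht.2]⟩
  set φ : ℝ → ℝ := IccExtend hle (fun t : Icc (A + r k) (B - r k / 2) => - Real.log (p t)) with hφ
  have hφeq : ∀ t ∈ Icc (A + r k) (B - r k / 2), φ t = - Real.log (p t) := fun t ht => by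
    rw [hφ, IccExtend_of_mem _ _ ht]
  have h := poincare_convex (a := A + r k) (b := B - r k) (c := B - r k / 2) (κ := κ) (by linarith) (by linarith) hκ
    (lt_of_lt_of_le (mul_lt_mul_of_pos_left (by linarith) hκ) hκb) φ G G'
    (continuous_IccExtend_iff.2 (continuousOn_iff_continuous_domRestrict.1 (hφcont.mono hsub)))
    ((hφc.subset hsub (convex_Icc _ _)).congr fun t ht => (hφeq t ht).symm) hG hG'
    (fun t ht => hGd t ⟨by linarith [ht.1], by linarith [ht.2]⟩)
  have heq : ∀ F : ℝ → ℝ, ∫ t in (A + r k)..(B - r k), F t * Real.exp (- φ t) = ∫ t in (A + r k)..(B - r k), F t * p t := by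
    intro F
    apply intervalIntegral.integral_congr
    intro t ht
    rw [uIcc_of_le (by linarith)] at ht
    have ht' : t ∈ Icc (A + r k) (B - r k / 2) := ⟨ht.1, by linarith [ht.2]⟩
    simp only
    rw [hφeq t ht', neg_neg, Real.exp_log (hin (hsub ht'))]
  have h1 := heq (fun _ => 1)
  simp only [one_mul] at h1
  rw [heq, heq G, h1, heq (fun t => G' t ^ 2)] at h
  exact h


lemma bm_compact {A B C : Set ℝ} (hA : IsCompact A) (hB : IsCompact B) (hAn : A.Nonempty) (hBn : B.Nonempty)
    (h : ∀ a ∈ A, ∀ b ∈ B, a + b ∈ C) : volume A + volume B ≤ volume C := by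
  have hM := hA.sSup_mem hAn
  have hm := hB.sInf_mem hBn
  set M := sSup A
  set m := sInf B
  have hMle : ∀ a ∈ A, a ≤ M := fun a ha => le_csSup hA.bddAbove ha
  have hmle : ∀ b ∈ B, m ≤ b := fun a ha => csInf_le hB.bddBelow ha
  have hsub : ((fun x => m + x) '' A) ∪ ((fun x => M + x) '' B) ⊆ C := by
    rintro _ (⟨a, ha, rfl⟩ | ⟨b, hb, rfl⟩)
    · simpa [add_comm] using h a ha m hm
    · exact h M hM b hb
  have hBc : IsCompact ((fun x => M + x) '' B) := hB.image (by fun_prop)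
  refine le_trans (le_of_eq ?_) (measure_mono hsub)
  rw [measure_union₀ hBc.measurableSet.nullMeasurableSet]
  · simp [image_add_left, measure_preimage_add]
  · refine measure_mono_null (t := {M + m}) ?_ (by simp)
    rintro _ ⟨⟨a, ha, rfl⟩, ⟨b, hb, hab⟩⟩
    have := hMle a ha
    have := hmle b hb
    simp only [mem_singleton_iff] at *
    linarith

lemma bm_one {A B C : Set ℝ} (hA : MeasurableSet A) (hB : MeasurableSet B) (hAn : A.Nonempty) (hBn : B.Nonempty)
    (h : ∀ a ∈ A, ∀ b ∈ B, a + b ∈ C) : volume A + volume B ≤ volume C := by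
  obtain ⟨a0, ha0⟩ := hAn
  obtain ⟨b0, hb0⟩ := hBn
  have e : ∀ S : Set ℝ, MeasurableSet S → volume S = ⨆ K : Set ℝ, ⨆ (_ : K ⊆ S ∧ IsCompact K), volume K := by
    intro S hS
    rw [hS.measure_eq_iSup_isCompact]
    simp_rw [iSup_and]
  rw [e A hA, e B hB]
  refine ENNReal.biSup_add_biSup_le' ⟨∅, by simp⟩ ⟨∅, by simp⟩ ?_
  rintro K ⟨hK, hKc⟩ L ⟨hL, hLc⟩
  calc volume K + volume L ≤ volume (insert a0 K) + volume (insert b0 L) := by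
        gcongr <;> exact subset_insert _ _
    _ ≤ _ := bm_compact (hKc.insert a0) (hLc.insert b0) (insert_nonempty _ _) (insert_nonempty _ _)
        fun a ha b hb => h a (insert_subset ha0 hK ha) b (insert_subset hb0 hL hb)

open scoped Pointwise in
lemma bm_comb {A B C : Set ℝ} {s : ℝ} (hs : 0 < s) (hs1 : s < 1) (hA : MeasurableSet A) (hB : MeasurableSet B) (hAn : A.Nonempty) (hBn : B.Nonempty)
    (h : ∀ a ∈ A, ∀ b ∈ B, (1 - s) * a + s * b ∈ C) :
    ENNReal.ofReal (1 - s) * volume A + ENNReal.ofReal s * volume B ≤ volume C := by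
  have h1 : 0 < 1 - s := by linarith
  have := bm_one (A := (1 - s) • A) (B := s • B) (C := C) (hA.const_smul₀ _) (hB.const_smul₀ _) (hAn.smul_set) (hBn.smul_set) ?_
  · rw [Measure.addHaar_smul, Measure.addHaar_smul] at this
    simpa [abs_of_pos hs, abs_of_pos h1] using this
  · rintro _ ⟨a, ha, rfl⟩ _ ⟨b, hb, rfl⟩
    exact h a ha b hb

lemma pl_level {f g h : ℝ → ℝ} {s : ℝ} (hs : 0 < s) (hs1 : s < 1)
    (mf : Measurable f) (mg : Measurable g) (mh : Measurable h)
    (f0 : ∀ x, 0 ≤ f x) (g0 : ∀ x, 0 ≤ g x) (h0 : ∀ x, 0 ≤ h x) (f1 : ∀ x, f x ≤ 1) (g1 : ∀ x, g x ≤ 1)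
    (fs : ∀ r < 1, ∃ x, r < f x) (gs : ∀ r < 1, ∃ x, r < g x)
    (H : ∀ r x y, 0 < r → r < f x → r < g y → r < h ((1 - s) * x + s * y)) :
    ENNReal.ofReal (1 - s) * (∫⁻ x, ENNReal.ofReal (f x)) + ENNReal.ofReal s * (∫⁻ x, ENNReal.ofReal (g x))
      ≤ ∫⁻ x, ENNReal.ofReal (h x) := by
  rw [lintegral_eq_lintegral_meas_lt _ (Eventually.of_forall f0) mf.aemeasurable,
    lintegral_eq_lintegral_meas_lt _ (Eventually.of_forall g0) mg.aemeasurable,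
    lintegral_eq_lintegral_meas_lt _ (Eventually.of_forall h0) mh.aemeasurable,
    ← lintegral_const_mul' _ _ ENNReal.ofReal_ne_top, ← lintegral_const_mul' _ _ ENNReal.ofReal_ne_top]
  have anti : ∀ k : ℝ → ℝ, Antitone (fun t => volume {a | t < k a}) := fun k t u htu =>
    measure_mono fun a ha => lt_of_le_of_lt htu ha
  rw [← lintegral_add_left ((anti f).measurable.const_mul _)]
  refine setLIntegral_mono' measurableSet_Ioi fun r hr => ?_
  by_cases hr1 : r < 1
  · obtain ⟨x, hx⟩ := fs r hr1
    obtain ⟨y, hy⟩ := gs r hr1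
    exact bm_comb hs hs1 (measurableSet_lt measurable_const mf) (measurableSet_lt measurable_const mg) ⟨x, hx⟩ ⟨y, hy⟩
      fun a ha b hb => H r a b hr ha hb
  · have e1 : {a | r < f a} = ∅ := by
      ext a; simp only [mem_ofPred_eq, mem_empty_iff_false, iff_false, not_lt]; linarith [f1 a]
    have e2 : {a | r < g a} = ∅ := by
      ext a; simp only [mem_ofPred_eq, mem_empty_iff_false, iff_false, not_lt]; linarith [g1 a]
    simp [e1, e2]

lemma amgm (x y : ℝ≥0∞) {s : ℝ} (hs : 0 < s) (hs1 : s < 1) :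
    x ^ (1 - s) * y ^ s ≤ ENNReal.ofReal (1 - s) * x + ENNReal.ofReal s * y := by
  have h1 : 0 < 1 - s := by linarith
  have hc : Real.HolderConjugate (1 - s)⁻¹ s⁻¹ := by
    constructor <;> simp [hs, h1]
  have := ENNReal.young_inequality (x ^ (1 - s)) (y ^ s) hc
  rw [← ENNReal.rpow_mul, ← ENNReal.rpow_mul, mul_inv_cancel₀ h1.ne', mul_inv_cancel₀ hs.ne', ENNReal.rpow_one, ENNReal.rpow_one,
    ENNReal.ofReal_inv_of_pos h1, ENNReal.ofReal_inv_of_pos hs, div_eq_mul_inv, div_eq_mul_inv, inv_inv, inv_inv] at this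
  rwa [mul_comm _ x, mul_comm _ y]

lemma pl_bdd {f g h : ℝ → ℝ≥0∞} {s : ℝ} (hs : 0 < s) (hs1 : s < 1)
    (mf : Measurable f) (mg : Measurable g) (mh : Measurable h) (N : ℝ≥0∞) (hN : N ≠ ∞)
    (fN : ∀ x, f x ≤ N) (gN : ∀ x, g x ≤ N)
    (H : ∀ x y, f x ^ (1 - s) * g y ^ s ≤ h ((1 - s) * x + s * y)) :
    (∫⁻ x, f x) ^ (1 - s) * (∫⁻ x, g x) ^ s ≤ ∫⁻ x, h x := by
  have h1 : 0 < 1 - s := by linarith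
  set F := ⨆ x, f x with hF
  set G := ⨆ x, g x with hG
  have fF : ∀ x, f x ≤ F := le_iSup f
  have gG : ∀ x, g x ≤ G := le_iSup g
  have Ft : F ≠ ∞ := ne_top_of_le_ne_top hN (iSup_le fN)
  have Gt : G ≠ ∞ := ne_top_of_le_ne_top hN (iSup_le gN)
  by_cases F0 : F = 0
  · have : ∀ x, f x = 0 := fun x => le_antisymm ((fF x).trans F0.le) zero_le
    simp [this, ENNReal.zero_rpow_of_pos h1]
  by_cases G0 : G = 0
  · have : ∀ x, g x = 0 := fun x => le_antisymm ((gG x).trans G0.le) zero_le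
    simp [this, ENNReal.zero_rpow_of_pos hs]
  set Q := F ^ (1 - s) * G ^ s with hQ
  have Q0 : Q ≠ 0 := by
    apply mul_ne_zero
    · exact (ENNReal.rpow_pos (pos_iff_ne_zero.2 F0) Ft).ne'
    · exact (ENNReal.rpow_pos (pos_iff_ne_zero.2 G0) Gt).ne'
  have Qt : Q ≠ ∞ := ENNReal.mul_ne_top (ENNReal.rpow_ne_top_of_nonneg h1.le Ft) (ENNReal.rpow_ne_top_of_nonneg hs.le Gt)
  have fd1 : ∀ x, f x / F ≤ 1 := fun x => ENNReal.div_le_of_le_mul (by simpa using fF x)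
  have gd1 : ∀ x, g x / G ≤ 1 := fun x => ENNReal.div_le_of_le_mul (by simpa using gG x)
  have hd1 : ∀ x, min (h x / Q) 1 ≤ 1 := fun x => min_le_right _ _
  have ft : ∀ x, f x / F ≠ ∞ := fun x => ne_top_of_le_ne_top ENNReal.one_ne_top (fd1 x)
  have gt : ∀ x, g x / G ≠ ∞ := fun x => ne_top_of_le_ne_top ENNReal.one_ne_top (gd1 x)
  have ht : ∀ x, min (h x / Q) 1 ≠ ∞ := fun x => ne_top_of_le_ne_top ENNReal.one_ne_top (hd1 x)
  have supaux : ∀ (k : ℝ → ℝ≥0∞), (⨆ x, k x) ≠ 0 → (⨆ x, k x) ≠ ∞ → (∀ x, k x / (⨆ x, k x) ≠ ∞) →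
      ∀ r < (1:ℝ), ∃ x, r < (k x / ⨆ x, k x).toReal := by
    intro k k0 kt kf r hr
    rcases lt_or_ge r 0 with h | h
    · exact ⟨0, h.trans_le ENNReal.toReal_nonneg⟩
    have : ENNReal.ofReal r * (⨆ x, k x) < ⨆ x, k x := by
      conv_rhs => rw [← one_mul (⨆ x, k x)]
      exact ENNReal.mul_lt_mul_left k0 kt (by simpa using hr)
    obtain ⟨x, hx⟩ := lt_iSup_iff.1 this
    refine ⟨x, (ENNReal.ofReal_lt_iff_lt_toReal h (kf x)).1 ?_⟩
    rwa [ENNReal.lt_div_iff_mul_lt (Or.inl k0) (Or.inl kt)]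
  have key := pl_level (f := fun x => (f x / F).toReal) (g := fun x => (g x / G).toReal)
    (h := fun x => (min (h x / Q) 1).toReal) hs hs1 (by fun_prop) (by fun_prop) (by fun_prop)
    (fun _ => ENNReal.toReal_nonneg) (fun _ => ENNReal.toReal_nonneg) (fun _ => ENNReal.toReal_nonneg)
    (fun x => ENNReal.toReal_le_of_le_ofReal zero_le_one (by simpa using fd1 x))
    (fun x => ENNReal.toReal_le_of_le_ofReal zero_le_one (by simpa using gd1 x))
    (supaux f F0 Ft ft) (supaux g G0 Gt gt) ?_
  · simp_rw [ENNReal.ofReal_toReal (ft _), ENNReal.ofReal_toReal (gt _), ENNReal.ofReal_toReal (ht _)] at key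
    have e1 : ∫⁻ x, f x / F = (∫⁻ x, f x) / F := by
      simp_rw [div_eq_mul_inv]; exact lintegral_mul_const' _ _ (ENNReal.inv_ne_top.2 F0)
    have e2 : ∫⁻ x, g x / G = (∫⁻ x, g x) / G := by
      simp_rw [div_eq_mul_inv]; exact lintegral_mul_const' _ _ (ENNReal.inv_ne_top.2 G0)
    have e3 : ∫⁻ x, min (h x / Q) 1 ≤ (∫⁻ x, h x) / Q := by
      have : ∫⁻ x, h x / Q = (∫⁻ x, h x) / Q := by
        simp_rw [div_eq_mul_inv]; exact lintegral_mul_const' _ _ (ENNReal.inv_ne_top.2 Q0)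
      rw [← this]
      exact lintegral_mono fun x => min_le_left _ _
    rw [e1, e2] at key
    have key2 := ((amgm _ _ hs hs1).trans key).trans e3
    rw [ENNReal.div_rpow_of_nonneg _ _ h1.le, ENNReal.div_rpow_of_nonneg _ _ hs.le,
      ENNReal.le_div_iff_mul_le (Or.inl Q0) (Or.inl Qt)] at key2
    refine le_trans (le_of_eq ?_) key2
    have a1 : F ^ (1 - s) ≠ 0 := (ENNReal.rpow_pos (pos_iff_ne_zero.2 F0) Ft).ne'
    have a2 : G ^ s ≠ 0 := (ENNReal.rpow_pos (pos_iff_ne_zero.2 G0) Gt).ne'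
    have a3 := ENNReal.rpow_ne_top_of_nonneg h1.le Ft
    have a4 := ENNReal.rpow_ne_top_of_nonneg hs.le Gt
    rw [hQ, mul_mul_mul_comm, ENNReal.div_mul_cancel a1 a3, ENNReal.div_mul_cancel a2 a4]
  · intro r x y hr hx hy
    rw [← ENNReal.ofReal_lt_iff_lt_toReal hr.le (ft x)] at hx
    rw [← ENNReal.ofReal_lt_iff_lt_toReal hr.le (gt y)] at hy
    rw [← ENNReal.ofReal_lt_iff_lt_toReal hr.le (ht _)]
    have hr1 : ENNReal.ofReal r < 1 := hx.trans_le (fd1 x)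
    refine lt_min ?_ hr1
    have r0 : ENNReal.ofReal r ≠ 0 := by simpa using hr
    calc ENNReal.ofReal r = ENNReal.ofReal r ^ (1 - s) * ENNReal.ofReal r ^ s := by
          rw [← ENNReal.rpow_add _ _ r0 ENNReal.ofReal_ne_top]; simp
      _ < (f x / F) ^ (1 - s) * (g y / G) ^ s :=
          ENNReal.mul_lt_mul (ENNReal.rpow_lt_rpow hx h1) (ENNReal.rpow_lt_rpow hy hs)
      _ = (f x ^ (1 - s) * g y ^ s) / Q := by
          rw [ENNReal.div_rpow_of_nonneg _ _ h1.le, ENNReal.div_rpow_of_nonneg _ _ hs.le, hQ]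
          rw [div_eq_mul_inv, div_eq_mul_inv, div_eq_mul_inv, ENNReal.mul_inv, mul_mul_mul_comm]
          · left; exact (ENNReal.rpow_pos (pos_iff_ne_zero.2 F0) Ft).ne'
          · left; exact ENNReal.rpow_ne_top_of_nonneg h1.le Ft
      _ ≤ _ := by gcongr; exact H x y

lemma pl_one {f g h : ℝ → ℝ≥0∞} {s : ℝ} (hs : 0 < s) (hs1 : s < 1)
    (mf : Measurable f) (mg : Measurable g) (mh : Measurable h)
    (H : ∀ x y, f x ^ (1 - s) * g y ^ s ≤ h ((1 - s) * x + s * y)) :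
    (∫⁻ x, f x) ^ (1 - s) * (∫⁻ x, g x) ^ s ≤ ∫⁻ x, h x := by
  have h1 : 0 < 1 - s := by linarith
  by_cases F0 : ∫⁻ x, f x = 0
  · simp [F0, ENNReal.zero_rpow_of_pos h1]
  by_cases G0 : ∫⁻ x, g x = 0
  · simp [G0, ENNReal.zero_rpow_of_pos hs]
  have lim : ∀ k : ℝ → ℝ≥0∞, Measurable k → Tendsto (fun n : ℕ => ∫⁻ x, min (k x) n) atTop (𝓝 (∫⁻ x, k x)) := by
    intro k mk
    apply lintegral_tendsto_of_tendsto_of_monotone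
    · intro n; fun_prop
    · refine Eventually.of_forall fun x n m hnm => ?_
      exact min_le_min_left _ (by exact_mod_cast hnm)
    · refine Eventually.of_forall fun x => ?_
      have := (tendsto_const_nhds (x := k x)).min ENNReal.tendsto_nat_nhds_top
      simpa using this
  have T : Tendsto (fun n : ℕ => (∫⁻ x, min (f x) n) ^ (1 - s) * (∫⁻ x, min (g x) n) ^ s) atTop
      (𝓝 ((∫⁻ x, f x) ^ (1 - s) * (∫⁻ x, g x) ^ s)) := by
    apply ENNReal.Tendsto.mul
    · exact (lim f mf).ennrpow_const _
    · left; simp [F0, hs1.le, hs1]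
    · exact (lim g mg).ennrpow_const _
    · left; simp [G0, hs.le, hs]
  refine le_of_tendsto' T fun n => ?_
  refine pl_bdd hs hs1 (by fun_prop) (by fun_prop) mh n (ENNReal.natCast_ne_top n) (fun x => min_le_right _ _) (fun x => min_le_right _ _) fun x y => ?_
  refine le_trans ?_ (H x y)
  gcongr <;> exact min_le_left _ _

theorem pl_pi (k : ℕ) : ∀ {f g h : (Fin k → ℝ) → ℝ≥0∞} {s : ℝ} (_ : 0 < s) (_ : s < 1)
    (_ : Measurable f) (_ : Measurable g) (_ : Measurable h)
    (_ : ∀ x y, f x ^ (1 - s) * g y ^ s ≤ h ((1 - s) • x + s • y)),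
    (∫⁻ x, f x) ^ (1 - s) * (∫⁻ x, g x) ^ s ≤ ∫⁻ x, h x := by
  induction k with
  | zero =>
    intro f g h s hs hs1 mf mg mh H
    simp only [lintegral_unique, volume_pi]
    have := H default default
    rw [Subsingleton.elim ((1 - s) • (default : Fin 0 → ℝ) + s • default) default] at this
    simp only [Measure.pi_univ, Finset.univ_eq_empty, Finset.prod_empty, mul_one]
    convert this
  | succ k ih =>
    intro f g h s hs hs1 mf mg mh H
    have e : ∀ q : (Fin (k + 1) → ℝ) → ℝ≥0∞, Measurable q → ∫⁻ x, q x = ∫⁻ t : ℝ, ∫⁻ y : Fin k → ℝ, q (Fin.cons t y) := by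
      intro q mq
      have mp := (volume_preserving_piFinSuccAbove (fun _ : Fin (k + 1) => ℝ) 0).symm
      rw [← mp.lintegral_comp mq, Measure.volume_eq_prod, lintegral_prod]
      · simp [MeasurableEquiv.piFinSuccAbove_symm_apply, Fin.insertNthEquiv, Fin.insertNth_zero']
      · exact (mq.comp mp.measurable).aemeasurable
    have mc : ∀ q : (Fin (k + 1) → ℝ) → ℝ≥0∞, Measurable q → Measurable (fun z : ℝ × (Fin k → ℝ) => q (Fin.cons z.1 z.2)) := by
      intro q mq
      apply mq.comp
      rw [measurable_pi_iff]
      intro i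
      refine Fin.cases ?_ (fun j => ?_) i
      · simpa using measurable_fst
      · simpa [Function.comp_def] using (measurable_pi_apply j).comp (measurable_snd (α := ℝ) (β := Fin k → ℝ))
    rw [e f mf, e g mg, e h mh]
    refine pl_one hs hs1 (mc f mf).lintegral_prod_right' (mc g mg).lintegral_prod_right' (mc h mh).lintegral_prod_right' ?_
    intro x y
    refine ih hs hs1 ((mc f mf).comp measurable_prodMk_left) ((mc g mg).comp measurable_prodMk_left) ((mc h mh).comp measurable_prodMk_left) ?_
    intro u v
    refine (H _ _).trans_eq ?_
    congr 1
    ext i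
    refine Fin.cases ?_ (fun j => ?_) i <;> simp


lemma exists_coords {k : ℕ} (v : EuclideanSpace ℝ (Fin (k + 1))) (hv : ‖v‖ = 1) :
    ∃ Ψ : (ℝ × (Fin k → ℝ)) → EuclideanSpace ℝ (Fin (k + 1)),
      MeasurePreserving Ψ ∧ MeasurableEmbedding Ψ ∧
      (∀ z u (c d : ℝ), Ψ (c • z + d • u) = c • Ψ z + d • Ψ u) ∧
      (∀ z, inner ℝ v (Ψ z) = z.1) ∧ ∀ z, ‖z.2‖ ≤ ‖Ψ z‖ := by
  have ho : Orthonormal ℝ (({0} : Set (Fin (k + 1))).domRestrict fun _ => v) := by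
    constructor
    · intro i; exact hv
    · intro i j hij
      exact absurd (Subsingleton.elim i j) hij
  obtain ⟨b, hb⟩ := ho.exists_orthonormalBasis_extension_of_card_eq (by simp)
  have hb0 : b 0 = v := hb 0 rfl
  let e := (MeasurableEquiv.piFinSuccAbove (fun _ : Fin (k + 1) => ℝ) 0).symm
  let Ψ : (ℝ × (Fin k → ℝ)) → EuclideanSpace ℝ (Fin (k + 1)) := fun z => b.repr.symm (WithLp.toLp 2 (e z))
  have hΨr : ∀ z i, b.repr (Ψ z) i = (Fin.cons z.1 z.2 : Fin (k + 1) → ℝ) i := by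
    intro z i
    simp [Ψ, e, MeasurableEquiv.piFinSuccAbove_symm_apply, Fin.insertNthEquiv, Fin.insertNth_zero']
  refine ⟨Ψ, ?_, ?_, ?_, ?_, ?_⟩
  · exact b.measurePreserving_repr_symm.comp ((PiLp.volume_preserving_toLp (Fin (k + 1))).comp (volume_preserving_piFinSuccAbove (fun _ : Fin (k + 1) => ℝ) 0).symm)
  · exact (b.repr.symm.toHomeomorph.measurableEmbedding).comp ((MeasurableEquiv.toLp 2 (Fin (k + 1) → ℝ)).measurableEmbedding.comp e.measurableEmbedding)
  · intro z u c d
    apply b.repr.injective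
    ext i
    simp only [map_add, map_smul, PiLp.add_apply, PiLp.smul_apply, hΨr]
    refine Fin.cases ?_ (fun j => ?_) i <;> simp
  · intro z
    rw [← hb0, ← b.repr_apply_apply, hΨr]; simp
  · intro z
    rw [pi_norm_le_iff_of_nonneg (norm_nonneg _)]
    intro i
    have := hΨr z i.succ
    simp only [Fin.cons_succ] at this
    rw [← this, b.repr_apply_apply]
    refine (norm_inner_le_norm _ _).trans ?_
    simp

lemma needle_poincare {k : ℕ} (v : EuclideanSpace ℝ (Fin (k + 1))) (hv : ‖v‖ = 1)
    (w : EuclideanSpace ℝ (Fin (k + 1)) → ℝ) (hw0 : ∀ x, 0 ≤ w x) (mw : Measurable w) (Cw R : ℝ)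
    (hwC : ∀ x, w x ≤ Cw) (hwR : ∀ x, w x ≠ 0 → ‖x‖ ≤ R)
    (hlc : ∀ x y (s : ℝ), 0 < s → s < 1 → w x ^ (1 - s) * w y ^ s ≤ w ((1 - s) • x + s • y))
    {α β κ : ℝ} (hκ : 0 < κ) (hκb : κ * (β - α) ≤ Real.pi)
    (hsupp : ∀ x, w x ≠ 0 → inner ℝ v x ∈ Icc α β)
    (G G' : ℝ → ℝ)
    (hG : Continuous G) (hG' : Continuous G') (C : ℝ) (hGb : ∀ t, |G t| ≤ C) (hGb' : ∀ t, |G' t| ≤ C)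
    (hGd : ∀ t ∈ Ioo α β, HasDerivAt G (G' t) t) :
    κ ^ 2 * ((∫ x, G (inner ℝ v x) ^ 2 * w x) * (∫ x, w x) - (∫ x, G (inner ℝ v x) * w x) ^ 2) ≤
      (∫ x, G' (inner ℝ v x) ^ 2 * w x) * (∫ x, w x) := by
  obtain ⟨Ψ, mp, me, lin, hin, hnorm⟩ := exists_coords v hv
  have hwabs : ∀ x, ‖w x‖ ≤ Cw := fun x => by rw [Real.norm_eq_abs, abs_of_nonneg (hw0 x)]; exact hwC x
  have wint : Integrable w := by
    have : IntegrableOn w (Metric.closedBall 0 R) :=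
      Measure.integrableOn_of_bounded (M := Cw) (isCompact_closedBall _ _).measure_lt_top.ne mw.aestronglyMeasurable (Eventually.of_forall hwabs)
    refine this.integrable_of_forall_notMem_eq_zero fun x hx => ?_
    by_contra h
    exact hx (by simpa using hwR x h)
  have sint : ∀ t, Integrable fun y => w (Ψ (t, y)) := by
    intro t
    have mm : Measurable fun y => w (Ψ (t, y)) := (mw.comp mp.measurable).comp measurable_prodMk_left
    have : IntegrableOn (fun y => w (Ψ (t, y))) (Metric.closedBall 0 R) :=
      Measure.integrableOn_of_bounded (M := Cw) (isCompact_closedBall _ _).measure_lt_top.ne mm.aestronglyMeasurable (Eventually.of_forall fun y => hwabs _)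
    refine this.integrable_of_forall_notMem_eq_zero fun y hy => ?_
    by_contra h
    exact hy (by simpa using (hnorm (t, y)).trans (hwR _ h))
  have wpi : Integrable (fun z => w (Ψ z)) := (mp.integrable_comp_emb me).2 wint
  set p : ℝ → ℝ := fun t => ∫ y, w (Ψ (t, y)) with hp
  have hpi : Integrable p := by
    rw [Measure.volume_eq_prod] at wpi
    exact wpi.integral_prod_left
  have tr : ∀ F : ℝ → ℝ, Continuous F → (∃ K, ∀ t, |F t| ≤ K) → ∫ x, F (inner ℝ v x) * w x = ∫ t, F t * p t := by
    rintro F hF ⟨K, hK⟩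
    rw [← mp.integral_comp me (fun x => F (inner ℝ v x) * w x)]
    simp_rw [hin]
    have : Integrable (fun z : ℝ × (Fin k → ℝ) => F z.1 * w (Ψ z)) :=
      wpi.bdd_mul (c := K) (hF.comp continuous_fst).aestronglyMeasurable (Eventually.of_forall fun z => hK _)
    rw [Measure.volume_eq_prod] at this ⊢
    rw [integral_prod _ this]
    simp_rw [integral_const_mul]
    rfl
  have p0 : ∀ t, 0 ≤ p t := fun t => integral_nonneg fun y => hw0 _
  have hpl : ∀ t, ENNReal.ofReal (p t) = ∫⁻ y, ENNReal.ofReal (w (Ψ (t, y))) := fun t =>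
    ofReal_integral_eq_lintegral_ofReal (sint t) (Eventually.of_forall fun y => hw0 _)
  have t0 := tr (fun _ => 1) continuous_const ⟨1, by simp⟩
  simp only [one_mul] at t0
  have sqb : ∀ x : ℝ, |x| ≤ C → |x ^ 2| ≤ C ^ 2 := fun x hx => by
    rw [abs_pow]; gcongr
  rw [t0, tr G hG ⟨C, hGb⟩, tr (fun t => G t ^ 2) (by fun_prop) ⟨C ^ 2, fun t => sqb _ (hGb t)⟩,
    tr (fun t => G' t ^ 2) (by fun_prop) ⟨C ^ 2, fun t => sqb _ (hGb' t)⟩]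
  refine poincare_logconcave hκ hκb p G G' p0 ?_ hpi ?_ hG hG' C hGb hGb' hGd
  · intro x y s hs hs1
    have h1 : 0 < 1 - s := by linarith
    rw [← ENNReal.ofReal_le_ofReal_iff (p0 _), ENNReal.ofReal_mul (Real.rpow_nonneg (p0 _) _),
      ← ENNReal.ofReal_rpow_of_nonneg (p0 _) h1.le, ← ENNReal.ofReal_rpow_of_nonneg (p0 _) hs.le, hpl, hpl, hpl]
    have mm : ∀ t, Measurable fun y => ENNReal.ofReal (w (Ψ (t, y))) := fun t => ((mw.comp mp.measurable).comp measurable_prodMk_left).ennreal_ofReal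
    refine pl_pi k hs hs1 (mm _) (mm _) (mm _) fun u u' => ?_
    rw [ENNReal.ofReal_rpow_of_nonneg (hw0 _) h1.le, ENNReal.ofReal_rpow_of_nonneg (hw0 _) hs.le, ← ENNReal.ofReal_mul (Real.rpow_nonneg (hw0 _) _)]
    apply ENNReal.ofReal_le_ofReal
    refine (hlc _ _ s hs hs1).trans_eq ?_
    rw [← lin]
    rfl
  · intro t ht
    by_contra h
    apply ht
    have : ∀ y, w (Ψ (t, y)) = 0 := fun y => by
      by_contra h'
      have := hsupp _ h'
      rw [hin] at this
      exact h this
    simp [hp, this]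


section loc
variable {n : ℕ}

lemma hyperplane_null (m p : EuclideanSpace ℝ (Fin n)) (hm : m ≠ 0) :
    volume {x : EuclideanSpace ℝ (Fin n) | inner ℝ m (x - p) = 0} = 0 := by
  have := Measure.addHaar_affineSubspace (volume : Measure (EuclideanSpace ℝ (Fin n)))
    (AffineSubspace.mk' p (LinearMap.ker (innerSL ℝ m).toLinearMap)) ?_
  · convert this using 2
    ext x
    simp [AffineSubspace.mem_mk']
  · intro h
    have h2 : m + p ∈ AffineSubspace.mk' p (LinearMap.ker (innerSL ℝ m).toLinearMap) := by rw [h]; trivial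
    simp [AffineSubspace.mem_mk'] at h2
    exact hm h2

noncomputable def dir (u v : EuclideanSpace ℝ (Fin n)) (θ : ℝ) : EuclideanSpace ℝ (Fin n) :=
  Real.cos θ • u + Real.sin θ • v

noncomputable def half (u v p : EuclideanSpace ℝ (Fin n)) (θ : ℝ) : Set (EuclideanSpace ℝ (Fin n)) :=
  {x | 0 ≤ inner ℝ (dir u v θ) (x - p)}

lemma continuous_dir (u v : EuclideanSpace ℝ (Fin n)) : Continuous (dir u v) := by
  unfold dir; fun_prop

lemma isClosed_half (u v p : EuclideanSpace ℝ (Fin n)) (θ : ℝ) : IsClosed (half u v p θ) :=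
  isClosed_le continuous_const (by fun_prop)

lemma convex_half (u v p : EuclideanSpace ℝ (Fin n)) (θ : ℝ) : Convex ℝ (half u v p θ) := by
  intro x hx y hy a b ha hb hab
  have : a • x + b • y - p = a • (x - p) + b • (y - p) := by
    have : p = (a + b) • p := by rw [hab, one_smul]
    conv_lhs => rw [this]
    module
  change 0 ≤ inner ℝ (dir u v θ) (a • x + b • y - p)
  rw [this, inner_add_right, inner_smul_right, inner_smul_right]
  exact add_nonneg (mul_nonneg ha hx) (mul_nonneg hb hy)

lemma dir_add_pi (u v : EuclideanSpace ℝ (Fin n)) (θ : ℝ) : dir u v (θ + Real.pi) = - dir u v θ := by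
  simp [dir, Real.cos_add_pi, Real.sin_add_pi]; abel

lemma half_split (μ : Measure (EuclideanSpace ℝ (Fin n))) (hμ : μ ≪ volume)
    (u v p : EuclideanSpace ℝ (Fin n)) (hd : ∀ θ, dir u v θ ≠ 0)
    (g : EuclideanSpace ℝ (Fin n) → ℝ) (hg : Integrable g μ) (θ : ℝ) :
    (∫ x in half u v p θ, g x ∂μ) + ∫ x in half u v p (θ + Real.pi), g x ∂μ = ∫ x, g x ∂μ := by
  rw [← integral_add_compl (isClosed_half u v p θ).measurableSet hg]
  congr 1
  apply setIntegral_congr_set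
  have : ∀ᵐ x ∂μ, inner ℝ (dir u v θ) (x - p) ≠ 0 := by
    have h' : ∀ᵐ x ∂(volume : Measure (EuclideanSpace ℝ (Fin n))), inner ℝ (dir u v θ) (x - p) ≠ 0 := by
      rw [ae_iff]
      simpa using hyperplane_null _ p (hd θ)
    exact hμ.ae_le h'
  filter_upwards [this] with x hx
  apply propext
  change (0 ≤ inner ℝ (dir u v (θ + Real.pi)) (x - p)) ↔ ¬ (0 ≤ inner ℝ (dir u v θ) (x - p))
  rw [dir_add_pi, inner_neg_left, not_le]
  constructor
  · intro h; exact lt_of_le_of_ne (by linarith) hx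
  · intro h; linarith

lemma half_continuous (μ : Measure (EuclideanSpace ℝ (Fin n))) (hμ : μ ≪ volume)
    (u v p : EuclideanSpace ℝ (Fin n)) (hd : ∀ θ, dir u v θ ≠ 0)
    (g : EuclideanSpace ℝ (Fin n) → ℝ) (hg : Integrable g μ) :
    Continuous fun θ => ∫ x in half u v p θ, g x ∂μ := by
  rw [continuous_iff_continuousAt]
  intro θ
  simp_rw [← integral_indicator (isClosed_half u v p _).measurableSet]
  apply continuousAt_of_dominated (bound := fun x => ‖g x‖)
  · exact Eventually.of_forall fun θ => hg.aestronglyMeasurable.indicator (isClosed_half u v p _).measurableSet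
  · exact Eventually.of_forall fun θ => Eventually.of_forall fun x => norm_indicator_le_norm_self _ _
  · exact hg.norm
  · have : ∀ᵐ x ∂μ, inner ℝ (dir u v θ) (x - p) ≠ 0 := by
      have h' : ∀ᵐ x ∂(volume : Measure (EuclideanSpace ℝ (Fin n))), inner ℝ (dir u v θ) (x - p) ≠ 0 := by
        rw [ae_iff]
        simpa using hyperplane_null _ p (hd θ)
      exact hμ.ae_le h'
    filter_upwards [this] with x hx
    have hc : Continuous fun θ => inner ℝ (dir u v θ) (x - p) := by
      have := continuous_dir u v
      fun_prop
    rcases lt_or_gt_of_ne hx with h | h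
    · have : (fun θ => (half u v p θ).indicator g x) =ᶠ[𝓝 θ] fun _ => 0 := by
        filter_upwards [hc.continuousAt.eventually_lt_const h] with θ' h'
        exact indicator_of_notMem (show x ∉ half u v p θ' from not_le.2 h') _
      exact continuousAt_const.congr this.symm
    · have : (fun θ => (half u v p θ).indicator g x) =ᶠ[𝓝 θ] fun _ => g x := by
        filter_upwards [hc.continuousAt.eventually_const_lt h] with θ' h'
        exact indicator_of_mem (show x ∈ half u v p θ' from le_of_lt h') _
      exact continuousAt_const.congr this.symm

lemma bisect (μ : Measure (EuclideanSpace ℝ (Fin n))) (hμ : μ ≪ volume)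
    (u v p : EuclideanSpace ℝ (Fin n)) (hd : ∀ θ, dir u v θ ≠ 0)
    (g k : EuclideanSpace ℝ (Fin n) → ℝ) (hg : Integrable g μ) (hk : Integrable k μ)
    (g0 : ∫ x, g x ∂μ = 0) (k0 : 0 < ∫ x, k x ∂μ) :
    ∃ θ, (∫ x in half u v p θ, g x ∂μ) = 0 ∧ 0 < ∫ x in half u v p θ, k x ∂μ := by
  have hc := half_continuous μ hμ u v p hd g hg
  have hs := half_split μ hμ u v p hd g hg
  have h0 := hs 0
  rw [g0] at h0
  have : ∃ θ, (∫ x in half u v p θ, g x ∂μ) = 0 := by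
    rcases le_total (∫ x in half u v p 0, g x ∂μ) 0 with h | h
    · exact mem_range_of_exists_le_of_exists_ge hc ⟨0, h⟩ ⟨0 + Real.pi, by linarith⟩
    · exact mem_range_of_exists_le_of_exists_ge hc ⟨0 + Real.pi, by linarith⟩ ⟨0, h⟩
  obtain ⟨θ, hθ⟩ := this
  have hk' := half_split μ hμ u v p hd k hk θ
  have hg' := hs θ
  rw [g0, hθ, zero_add] at hg'
  by_cases h : 0 < ∫ x in half u v p θ, k x ∂μ
  · exact ⟨θ, hθ, h⟩
  · exact ⟨θ + Real.pi, hg', by linarith⟩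

lemma exists_cuts (K0 : Set (EuclideanSpace ℝ (Fin n))) (hK : IsCompact K0) (hconv : Convex ℝ K0)
    (g k : EuclideanSpace ℝ (Fin n) → ℝ) (hg : IntegrableOn g K0) (hk : IntegrableOn k K0)
    (g0 : ∫ x in K0, g x = 0) (k0 : 0 < ∫ x in K0, k x)
    (U V P : ℕ → EuclideanSpace ℝ (Fin n)) :
    ∃ K : ℕ → Set (EuclideanSpace ℝ (Fin n)), (∀ i, K (i + 1) ⊆ K i) ∧
      (∀ i, IsCompact (K i) ∧ Convex ℝ (K i) ∧ K i ⊆ K0 ∧ (∫ x in K i, g x = 0) ∧ 0 < ∫ x in K i, k x) ∧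
      ∀ i, (∀ θ, dir (U i) (V i) θ ≠ 0) → ∃ θ, K (i + 1) ⊆ half (U i) (V i) (P i) θ := by
  let Q : Set (EuclideanSpace ℝ (Fin n)) → Prop := fun K => IsCompact K ∧ Convex ℝ K ∧ K ⊆ K0 ∧ (∫ x in K, g x = 0) ∧ 0 < ∫ x in K, k x
  have step : ∀ (i : ℕ) (K : {K // Q K}), ∃ L : {K // Q K}, L.1 ⊆ K.1 ∧ ((∀ θ, dir (U i) (V i) θ ≠ 0) → ∃ θ, L.1 ⊆ half (U i) (V i) (P i) θ) := by
    rintro i ⟨K, hKc, hKv, hKs, hKg, hKk⟩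
    by_cases hd : ∀ θ, dir (U i) (V i) θ ≠ 0
    · obtain ⟨θ, h1, h2⟩ := bisect (volume.restrict K) Measure.absolutelyContinuous_restrict (U i) (V i) (P i) hd g k
        (hg.mono_set hKs) (hk.mono_set hKs) hKg hKk
      have hcl := isClosed_half (U i) (V i) (P i) θ
      rw [Measure.restrict_restrict hcl.measurableSet] at h1 h2
      exact ⟨⟨half (U i) (V i) (P i) θ ∩ K, hKc.inter_left hcl, (convex_half _ _ _ _).inter hKv, inter_subset_right.trans hKs, h1, h2⟩,
        inter_subset_right, fun _ => ⟨θ, inter_subset_left⟩⟩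
    · exact ⟨⟨K, hKc, hKv, hKs, hKg, hKk⟩, subset_rfl, fun h => absurd h hd⟩
  choose F hF1 hF2 using step
  let S : ℕ → {K // Q K} := fun i => Nat.rec ⟨K0, hK, hconv, subset_rfl, g0, k0⟩ (fun i K => F i K) i
  exact ⟨fun i => (S i).1, fun i => hF1 i (S i), fun i => (S i).2, fun i => hF2 i (S i)⟩

lemma no_triangle (x y z : EuclideanSpace ℝ (Fin n)) (hli : LinearIndependent ℝ ![y - x, z - x]) :
    ∃ O : Set (EuclideanSpace ℝ (Fin n) × EuclideanSpace ℝ (Fin n) × EuclideanSpace ℝ (Fin n)), IsOpen O ∧ O.Nonempty ∧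
      ∀ q ∈ O, ∀ θ, x ∉ half q.1 q.2.1 q.2.2 θ ∨ y ∉ half q.1 q.2.1 q.2.2 θ ∨ z ∉ half q.1 q.2.1 q.2.2 θ := by
  let Φ : (EuclideanSpace ℝ (Fin n) × EuclideanSpace ℝ (Fin n) × EuclideanSpace ℝ (Fin n)) → ℝ → ℝ := fun q θ =>
    min (inner ℝ (dir q.1 q.2.1 θ) (x - q.2.2)) (min (inner ℝ (dir q.1 q.2.1 θ) (y - q.2.2)) (inner ℝ (dir q.1 q.2.1 θ) (z - q.2.2)))
  have hΦ : Continuous fun r : (EuclideanSpace ℝ (Fin n) × EuclideanSpace ℝ (Fin n) × EuclideanSpace ℝ (Fin n)) × ℝ => Φ r.1 r.2 := by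
    simp only [Φ, dir]; fun_prop
  let q0 : EuclideanSpace ℝ (Fin n) × EuclideanSpace ℝ (Fin n) × EuclideanSpace ℝ (Fin n) := (y - x, z - x, (1/3 : ℝ) • (x + y + z))
  have hq0 : ∀ θ, Φ q0 θ < 0 := by
    intro θ
    by_contra h
    simp only [Φ, q0, not_lt, le_min_iff] at h
    obtain ⟨hx, hy, hz⟩ := h
    set p := (1/3 : ℝ) • (x + y + z) with hp
    set m := dir (y - x) (z - x) θ with hm
    have hsum : inner ℝ m (x - p) + inner ℝ m (y - p) + inner ℝ m (z - p) = 0 := by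
      rw [← inner_add_right, ← inner_add_right]
      have : x - p + (y - p) + (z - p) = 0 := by rw [hp]; module
      rw [this, inner_zero_right]
    have e1 : inner ℝ m (y - x) = 0 := by
      have : y - x = (y - p) - (x - p) := by abel
      rw [this, inner_sub_right]; linarith
    have e2 : inner ℝ m (z - x) = 0 := by
      have : z - x = (z - p) - (x - p) := by abel
      rw [this, inner_sub_right]; linarith
    have e3 : inner ℝ m m = 0 := by
      nth_rewrite 2 [hm]
      rw [dir, inner_add_right, inner_smul_right, inner_smul_right, e1, e2]; simp
    rw [inner_self_eq_zero] at e3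
    have := (LinearIndependent.pair_iff.1 hli) _ _ e3
    have h2 := Real.sin_sq_add_cos_sq θ
    rw [this.1, this.2] at h2
    norm_num at h2
  have hev : ∀ᶠ q in 𝓝 q0, ∀ θ ∈ Icc 0 (2 * Real.pi), Φ q θ < 0 := by
    apply isCompact_Icc.eventually_forall_of_forall_eventually
    intro θ _
    exact hΦ.continuousAt.eventually_lt_const (hq0 θ)
  obtain ⟨O, hO, hOo, hqO⟩ := eventually_nhds_iff.1 hev
  refine ⟨O, hOo, ⟨q0, hqO⟩, fun q hq θ => ?_⟩
  have per : Function.Periodic (Φ q) (2 * Real.pi) := by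
    intro θ; simp [Φ, dir]
  obtain ⟨θ', hθ', he⟩ := per.exists_mem_Ico₀ (by positivity) θ
  have := hO q hq θ' ⟨hθ'.1, hθ'.2.le⟩
  rw [← he] at this
  by_contra hcon
  push Not at hcon
  exact absurd this (not_lt.2 (le_min hcon.1 (le_min hcon.2.1 hcon.2.2)))

lemma localization (hn : 0 < n) (K0 : Set (EuclideanSpace ℝ (Fin n))) (hK : IsCompact K0) (hconv : Convex ℝ K0)
    (g k : EuclideanSpace ℝ (Fin n) → ℝ) (hg : IntegrableOn g K0) (hk : IntegrableOn k K0)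
    (g0 : ∫ x in K0, g x = 0) (k0 : 0 < ∫ x in K0, k x) (δ : ℝ) (hδ : 0 < δ) :
    ∃ (K : Set (EuclideanSpace ℝ (Fin n))) (a v : EuclideanSpace ℝ (Fin n)), IsCompact K ∧ Convex ℝ K ∧ K ⊆ K0 ∧
      (∫ x in K, g x = 0) ∧ (0 < ∫ x in K, k x) ∧ ‖v‖ = 1 ∧ ∀ x ∈ K, ∃ t : ℝ, dist x (a + t • v) < δ := by
  let d := TopologicalSpace.denseSeq (EuclideanSpace ℝ (Fin n) × EuclideanSpace ℝ (Fin n) × EuclideanSpace ℝ (Fin n))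
  obtain ⟨K, hmono, hprop, hcut⟩ := exists_cuts K0 hK hconv g k hg hk g0 k0 (fun i => (d i).1) (fun i => (d i).2.1) (fun i => (d i).2.2)
  have hne : ∀ i, (K i).Nonempty := by
    intro i
    by_contra h
    rw [not_nonempty_iff_eq_empty] at h
    have := (hprop i).2.2.2.2
    simp [h] at this
  have hanti : Antitone K := antitone_nat_of_succ_le hmono
  obtain ⟨a, ha⟩ := IsCompact.nonempty_iInter_of_sequence_nonempty_isCompact_isClosed K hmono hne (hprop 0).1 (fun i => (hprop i).1.isClosed)
  have hcol : ∀ x ∈ ⋂ i, K i, ∀ y ∈ ⋂ i, K i, ∀ z ∈ ⋂ i, K i, ¬ LinearIndependent ℝ ![y - x, z - x] := by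
    intro x hx y hy z hz hli
    rw [mem_iInter] at hx hy hz
    obtain ⟨O, hO, hOn, h⟩ := no_triangle x y z hli
    obtain ⟨i, hi⟩ := (TopologicalSpace.denseRange_denseSeq _).exists_mem_open hO hOn
    have hi2 := h _ hi
    have hd : ∀ θ, dir (d i).1 (d i).2.1 θ ≠ 0 := by
      intro θ h0
      have := hi2 θ
      simp only [half] at this
      change _ ∉ {x | 0 ≤ inner ℝ (dir (d i).1 (d i).2.1 θ) (x - (d i).2.2)} ∨ _ ∉ {x | 0 ≤ inner ℝ (dir (d i).1 (d i).2.1 θ) (x - (d i).2.2)} ∨ _ ∉ {x | 0 ≤ inner ℝ (dir (d i).1 (d i).2.1 θ) (x - (d i).2.2)} at this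
      rw [h0] at this
      simp at this
    obtain ⟨θ, hθ⟩ := hcut i hd
    rcases hi2 θ with h | h | h
    · exact h (hθ (hx _))
    · exact h (hθ (hy _))
    · exact h (hθ (hz _))
  have hline : ∃ v : EuclideanSpace ℝ (Fin n), ‖v‖ = 1 ∧ ∀ x ∈ ⋂ i, K i, ∃ t : ℝ, x = a + t • v := by
    by_cases hb : ∃ b ∈ ⋂ i, K i, b ≠ a
    · obtain ⟨b, hb, hba⟩ := hb
      have hba' : b - a ≠ 0 := sub_ne_zero.2 hba
      refine ⟨‖b - a‖⁻¹ • (b - a), norm_smul_inv_norm hba', fun x hx => ?_⟩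
      have := hcol a ha b hb x hx
      rw [LinearIndependent.pair_iff' hba'] at this
      push Not at this
      obtain ⟨c, hc⟩ := this
      refine ⟨c * ‖b - a‖, ?_⟩
      rw [smul_smul, mul_assoc, mul_inv_cancel₀ (norm_ne_zero_iff.2 hba'), mul_one, hc]
      abel
    · push Not at hb
      refine ⟨EuclideanSpace.single ⟨0, hn⟩ 1, by simp, fun x hx => ⟨0, by simp [hb x hx]⟩⟩
  obtain ⟨v, hv, hv2⟩ := hline
  obtain ⟨i, hi⟩ := exists_subset_nhds_of_isCompact (V := K) hanti.directed_ge (fun i => (hprop i).1) (U := Metric.thickening δ (⋂ i, K i))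
    (fun x hx => Metric.isOpen_thickening.mem_nhds (Metric.self_subset_thickening hδ _ hx))
  refine ⟨K i, a, v, (hprop i).1, (hprop i).2.1, (hprop i).2.2.1, (hprop i).2.2.2.1, (hprop i).2.2.2.2, hv, fun x hx => ?_⟩
  obtain ⟨z, hz, hxz⟩ := Metric.mem_thickening_iff.1 (hi hx)
  obtain ⟨t, rfl⟩ := hv2 z hz
  exact ⟨t, hxz⟩

end loc


lemma proj_dist {n : ℕ} (a v x : EuclideanSpace ℝ (Fin n)) (hv : ‖v‖ = 1) (t : ℝ) :
    dist x (a + (inner ℝ v x - inner ℝ v a) • v) ≤ dist x (a + t • v) := by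
  rw [dist_eq_norm, dist_eq_norm, ← sub_sub, ← sub_sub, ← inner_sub_right]
  generalize x - a = z
  refine (sq_le_sq₀ (norm_nonneg _) (norm_nonneg _)).1 ?_
  rw [norm_sub_sq_real, norm_sub_sq_real, inner_smul_right, inner_smul_right, norm_smul, norm_smul, hv,
    real_inner_comm v z]
  simp only [mul_one, Real.norm_eq_abs, sq_abs]
  nlinarith [sq_nonneg (t - inner ℝ v z)]

lemma needle_step {k : ℕ} (K : Set (EuclideanSpace ℝ (Fin (k + 1)))) (hK : IsCompact K) (hKc : Convex ℝ K)
    (hKn : volume K ≠ 0) (Ω : Set (EuclideanSpace ℝ (Fin (k + 1)))) (hKΩ : K ⊆ Ω)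
    (W f : EuclideanSpace ℝ (Fin (k + 1)) → ℝ) (f' : EuclideanSpace ℝ (Fin (k + 1)) → EuclideanSpace ℝ (Fin (k + 1)))
    (hW : ContinuousOn W Ω) (hW0 : ∀ x ∈ Ω, 0 < W x)
    (hlc : ∀ x ∈ K, ∀ y ∈ K, ∀ s : ℝ, 0 < s → s < 1 → W x ^ (1 - s) * W y ^ s ≤ W ((1 - s) • x + s • y))
    (hf : ContinuousOn f Ω) (hf' : ContinuousOn f' Ω) (hfd : ∀ x ∈ Ω, HasGradientAt f (f' x) x)
    {κ : ℝ} (hκ : 0 < κ) (hκb : ∀ x ∈ K, ∀ y ∈ K, κ * dist x y ≤ Real.pi)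
    (h0 : ∫ x in K, f x * W x = 0) (δ ε : ℝ)
    (hU : ∀ x ∈ K, ∀ y, dist x y < δ → y ∈ Ω ∧ |f x - f y| ≤ ε ∧ |f x ^ 2 - f y ^ 2| ≤ ε ∧ |‖f' x‖ ^ 2 - ‖f' y‖ ^ 2| ≤ ε)
    (a v : EuclideanSpace ℝ (Fin (k + 1))) (hv : ‖v‖ = 1) (hav : ∀ x ∈ K, ∃ t : ℝ, dist x (a + t • v) < δ) :
    κ ^ 2 * (∫ x in K, f x ^ 2 * W x) - ∫ x in K, ‖f' x‖ ^ 2 * W x ≤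
      (ε + κ ^ 2 * ε + κ ^ 2 * ε ^ 2) * ∫ x in K, W x := by
  have hne : K.Nonempty := by
    by_contra h
    rw [not_nonempty_iff_eq_empty] at h
    simp [h] at hKn
  let L : ℝ → EuclideanSpace ℝ (Fin (k + 1)) := fun t => a + (t - inner ℝ v a) • v
  have hLc : Continuous L := by fun_prop
  have hLd : ∀ x ∈ K, dist x (L (inner ℝ v x)) < δ := by
    intro x hx
    obtain ⟨t, ht⟩ := hav x hx
    exact (proj_dist a v x hv t).trans_lt ht
  have hic : Continuous fun x : EuclideanSpace ℝ (Fin (k + 1)) => inner ℝ v x := by fun_prop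
  obtain ⟨x1, hx1, hm1⟩ := hK.exists_isMinOn hne hic.continuousOn
  obtain ⟨x2, hx2, hm2⟩ := hK.exists_isMaxOn hne hic.continuousOn
  set α : ℝ := inner ℝ v x1 with hα
  set β : ℝ := inner ℝ v x2 with hβ
  have hIcc : ∀ x ∈ K, inner ℝ v x ∈ Icc α β := fun x hx => ⟨hm1 hx, hm2 hx⟩
  have hαβ : α ≤ β := hm1 hx2
  have hsurj : ∀ t ∈ Icc α β, ∃ x ∈ K, inner ℝ v x = t := by
    intro t ht
    exact hKc.isPreconnected.intermediate_value hx1 hx2 hic.continuousOn ht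
  have hLΩ : ∀ t ∈ Icc α β, L t ∈ Ω := by
    intro t ht
    obtain ⟨x, hx, rfl⟩ := hsurj t ht
    exact (hU x hx _ (hLd x hx)).1
  have hba : κ * (β - α) ≤ Real.pi := by
    refine le_trans ?_ (hκb x2 hx2 x1 hx1)
    apply mul_le_mul_of_nonneg_left _ hκ.le
    rw [hα, hβ, ← inner_sub_right, dist_eq_norm]
    have := real_inner_le_norm v (x2 - x1)
    rwa [hv, one_mul] at this
  let P : ℝ → ℝ := fun t => (projIcc α β hαβ t : ℝ)
  have hPc : Continuous P := continuous_subtype_val.comp continuous_projIcc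
  have hPm : ∀ t, P t ∈ Icc α β := fun t => (projIcc α β hαβ t).2
  have hPe : ∀ t ∈ Icc α β, P t = t := fun t ht => by simp [P, projIcc_of_mem hαβ ht]
  let G : ℝ → ℝ := fun t => f (L (P t))
  let G' : ℝ → ℝ := fun t => inner ℝ (f' (L (P t))) v
  have hG : Continuous G := hf.comp_continuous (hLc.comp hPc) fun t => hLΩ _ (hPm t)
  have hf'L : Continuous fun t => f' (L (P t)) := hf'.comp_continuous (hLc.comp hPc) fun t => hLΩ _ (hPm t)
  have hG' : Continuous G' := hf'L.inner continuous_const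
  have hGP : ∀ t, G (P t) = G t := fun t => by simp only [G]; rw [hPe _ (hPm t)]
  have hGP' : ∀ t, G' (P t) = G' t := fun t => by simp only [G']; rw [hPe _ (hPm t)]
  obtain ⟨C1, hC1⟩ := (isCompact_Icc (a := α) (b := β)).exists_bound_of_continuousOn hG.continuousOn
  obtain ⟨C2, hC2⟩ := (isCompact_Icc (a := α) (b := β)).exists_bound_of_continuousOn hG'.continuousOn
  have hGd : ∀ t ∈ Ioo α β, HasDerivAt G (G' t) t := by
    intro t ht
    have htI := Ioo_subset_Icc_self ht
    have h1 : HasDerivAt L v t := by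
      have := (((hasDerivAt_id t).sub_const (inner ℝ v a)).smul_const v).const_add a
      simpa [L] using this
    have h2 := (hfd (L t) (hLΩ t htI)).hasFDerivAt.comp_hasDerivAt t h1
    have h3 : G' t = InnerProductSpace.toDual ℝ _ (f' (L t)) v := by
      simp only [G', hPe t htI]; rfl
    rw [h3]
    apply h2.congr_of_eventuallyEq
    filter_upwards [Ioo_mem_nhds ht.1 ht.2] with s hs
    simp only [G, hPe s (Ioo_subset_Icc_self hs)]; rfl
  have hWK : ContinuousOn W K := hW.mono hKΩ
  obtain ⟨Cw, hCw⟩ := hK.exists_bound_of_continuousOn hWK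
  obtain ⟨R, hR⟩ := hK.isBounded.exists_norm_le
  let w : EuclideanSpace ℝ (Fin (k + 1)) → ℝ := K.indicator W
  have hwn : ∀ x, w x ≠ 0 → x ∈ K := fun x hx => by
    by_contra h; exact hx (indicator_of_notMem h _)
  have hwK : ∀ x ∈ K, w x = W x := fun x hx => indicator_of_mem hx _
  have hw0 : ∀ x, 0 ≤ w x := fun x => indicator_nonneg (fun x hx => (hW0 x (hKΩ hx)).le) x
  have mw : Measurable w := by
    classical
    have := ContinuousOn.measurable_piecewise hWK (continuousOn_const (c := (0:ℝ)) (s := Kᶜ)) hK.measurableSet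
    have h2 : w = K.piecewise W (fun _ => 0) := (piecewise_eq_indicator (s := K) (f := W)).symm
    rw [h2]; exact this
  have key := needle_poincare v hv w hw0 mw (max Cw 0) R
    (fun x => by
      by_cases hx : x ∈ K
      · rw [hwK x hx]; exact le_max_of_le_left ((le_abs_self _).trans (hCw x hx))
      · simp [w, hx])
    (fun x hx => hR x (hwn x hx))
    (fun x y s hs hs1 => by
      by_cases hx : x ∈ K
      · by_cases hy : y ∈ K
        · rw [hwK x hx, hwK y hy, hwK _ (hKc hx hy (by linarith) hs.le (by ring))]
          exact hlc x hx y hy s hs hs1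
        · have : w y = 0 := indicator_of_notMem hy _
          rw [this, Real.zero_rpow hs.ne', mul_zero]; exact hw0 _
      · have : w x = 0 := indicator_of_notMem hx _
        rw [this, Real.zero_rpow (by linarith), zero_mul]; exact hw0 _)
    hκ hba (fun x hx => hIcc x (hwn x hx)) G G' hG hG' (max C1 C2)
    (fun t => by rw [← hGP]; exact le_max_of_le_left (hC1 _ (hPm t)))
    (fun t => by rw [← hGP']; exact le_max_of_le_right (hC2 _ (hPm t))) hGd
  have conv : ∀ F : EuclideanSpace ℝ (Fin (k + 1)) → ℝ, ∫ x, F x * w x = ∫ x in K, F x * W x := by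
    intro F
    rw [← integral_indicator hK.measurableSet]
    congr 1
    ext x
    by_cases hx : x ∈ K <;> simp [w, hx]
  have conv1 : ∫ x, w x = ∫ x in K, W x := integral_indicator hK.measurableSet
  rw [conv (fun x => G (inner ℝ v x) ^ 2), conv (fun x => G (inner ℝ v x)), conv (fun x => G' (inner ℝ v x) ^ 2), conv1] at key
  have iW : IntegrableOn W K := hWK.integrableOn_compact hK
  have hfK := hf.mono hKΩ
  have hf'K := hf'.mono hKΩ
  have iA : IntegrableOn (fun x => f x ^ 2 * W x) K := ((hfK.pow 2).mul hWK).integrableOn_compact hK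
  have iB : IntegrableOn (fun x => ‖f' x‖ ^ 2 * W x) K := ((hf'K.norm.pow 2).mul hWK).integrableOn_compact hK
  have iF : IntegrableOn (fun x => f x * W x) K := (hfK.mul hWK).integrableOn_compact hK
  have iG : IntegrableOn (fun x => G (inner ℝ v x) * W x) K := ((hG.comp hic).continuousOn.mul hWK).integrableOn_compact hK
  have iG2 : IntegrableOn (fun x => G (inner ℝ v x) ^ 2 * W x) K := (((hG.comp hic).pow 2).continuousOn.mul hWK).integrableOn_compact hK
  have iG'2 : IntegrableOn (fun x => G' (inner ℝ v x) ^ 2 * W x) K := (((hG'.comp hic).pow 2).continuousOn.mul hWK).integrableOn_compact hK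
  have hGx : ∀ x ∈ K, G (inner ℝ v x) = f (L (inner ℝ v x)) := fun x hx => by
    simp only [G, hPe _ (hIcc x hx)]
  have hGx' : ∀ x ∈ K, G' (inner ℝ v x) ^ 2 ≤ ‖f' (L (inner ℝ v x))‖ ^ 2 := fun x hx => by
    simp only [G', hPe _ (hIcc x hx)]
    have := abs_real_inner_le_norm (f' (L (inner ℝ v x))) v
    rw [hv, mul_one] at this
    rw [← sq_abs]
    gcongr
  have hM : 0 < ∫ x in K, W x := by
    rw [setIntegral_pos_iff_support_of_nonneg_ae _ iW]
    · have : Function.support W ∩ K = K := inter_eq_right.2 fun x hx => (hW0 x (hKΩ hx)).ne'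
      rw [this]; exact pos_iff_ne_zero.2 hKn
    · filter_upwards [ae_restrict_mem hK.measurableSet] with x hx using (hW0 x (hKΩ hx)).le
  set M := ∫ x in K, W x with hMd
  have est : ∀ F H : EuclideanSpace ℝ (Fin (k + 1)) → ℝ, IntegrableOn (fun x => F x * W x) K → IntegrableOn (fun x => H x * W x) K →
      (∀ x ∈ K, F x ≤ H x + ε) → (∫ x in K, F x * W x) ≤ (∫ x in K, H x * W x) + ε * M := by
    intro F H iF iH h
    rw [hMd, ← integral_const_mul, ← integral_add iH (iW.const_mul ε)]
    apply setIntegral_mono_on iF (iH.add (iW.const_mul ε)) hK.measurableSet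
    intro x hx
    have h1 := h x hx
    have h2 := hW0 x (hKΩ hx)
    change F x * W x ≤ H x * W x + ε * W x
    nlinarith
  have eA := est (fun x => f x ^ 2) (fun x => G (inner ℝ v x) ^ 2) iA iG2 (fun x hx => by
    have h := (abs_le.1 (hU x hx _ (hLd x hx)).2.2.1).2
    rw [hGx x hx]; linarith)
  have eB := est (fun x => G' (inner ℝ v x) ^ 2) (fun x => ‖f' x‖ ^ 2) iG'2 iB (fun x hx => by
    have h := (abs_le.1 (hU x hx _ (hLd x hx)).2.2.2).1
    have h2 := hGx' x hx
    linarith)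
  have eI1 := est (fun x => G (inner ℝ v x)) f iG iF (fun x hx => by
    have h := (abs_le.1 (hU x hx _ (hLd x hx)).2.1).1
    rw [hGx x hx]; linarith)
  have eI2 := est f (fun x => G (inner ℝ v x)) iF iG (fun x hx => by
    have h := (abs_le.1 (hU x hx _ (hLd x hx)).2.1).2
    rw [hGx x hx]; linarith)
  rw [h0] at eI1 eI2
  rw [zero_add] at eI1
  beta_reduce at eA eB eI1 eI2
  have eI : (∫ x in K, G (inner ℝ v x) * W x) ^ 2 ≤ (ε * M) ^ 2 := sq_le_sq' (by linarith) eI1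
  generalize (∫ x in K, G (inner ℝ v x) * W x) = I at *
  generalize (∫ x in K, G (inner ℝ v x) ^ 2 * W x) = J at *
  generalize (∫ x in K, G' (inner ℝ v x) ^ 2 * W x) = J' at *
  generalize (∫ x in K, ‖f' x‖ ^ 2 * W x) = B at *
  generalize (∫ x in K, f x ^ 2 * W x) = A at *
  have hk2 : 0 < κ ^ 2 := by positivity
  apply le_of_mul_le_mul_right _ hM
  have s1 : κ ^ 2 * A * M ≤ κ ^ 2 * (J + ε * M) * M := by gcongr
  have s2 : J' * M ≤ (B + ε * M) * M := by gcongr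
  have s3 : κ ^ 2 * I ^ 2 ≤ κ ^ 2 * (ε * M) ^ 2 := by gcongr
  nlinarith

lemma compact_zero {k : ℕ} (K : Set (EuclideanSpace ℝ (Fin (k + 1)))) (hK : IsCompact K) (hKc : Convex ℝ K)
    (Ω : Set (EuclideanSpace ℝ (Fin (k + 1)))) (ho : IsOpen Ω) (hKΩ : K ⊆ Ω)
    (W f : EuclideanSpace ℝ (Fin (k + 1)) → ℝ) (f' : EuclideanSpace ℝ (Fin (k + 1)) → EuclideanSpace ℝ (Fin (k + 1)))
    (hW : ContinuousOn W Ω) (hW0 : ∀ x ∈ Ω, 0 < W x)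
    (hlc : ∀ x ∈ K, ∀ y ∈ K, ∀ s : ℝ, 0 < s → s < 1 → W x ^ (1 - s) * W y ^ s ≤ W ((1 - s) • x + s • y))
    (hf : ContinuousOn f Ω) (hf' : ContinuousOn f' Ω) (hfd : ∀ x ∈ Ω, HasGradientAt f (f' x) x)
    {κ : ℝ} (hκ : 0 < κ) (hκb : ∀ x ∈ K, ∀ y ∈ K, κ * dist x y ≤ Real.pi)
    (h0 : ∫ x in K, f x * W x = 0) :
    κ ^ 2 * (∫ x in K, f x ^ 2 * W x) ≤ ∫ x in K, ‖f' x‖ ^ 2 * W x := by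
  by_contra hcon
  rw [not_le] at hcon
  have hWK := hW.mono hKΩ
  have hfK := hf.mono hKΩ
  have hf'K := hf'.mono hKΩ
  have iW : IntegrableOn W K := hWK.integrableOn_compact hK
  have iA : IntegrableOn (fun x => f x ^ 2 * W x) K := ((hfK.pow 2).mul hWK).integrableOn_compact hK
  have iB : IntegrableOn (fun x => ‖f' x‖ ^ 2 * W x) K := ((hf'K.norm.pow 2).mul hWK).integrableOn_compact hK
  have iF : IntegrableOn (fun x => f x * W x) K := (hfK.mul hWK).integrableOn_compact hK
  have hM0 : 0 ≤ ∫ x in K, W x := setIntegral_nonneg hK.measurableSet fun x hx => (hW0 x (hKΩ hx)).le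
  obtain ⟨c, hc, hcM⟩ : ∃ c > 0, c * (∫ x in K, W x) < κ ^ 2 * (∫ x in K, f x ^ 2 * W x) - ∫ x in K, ‖f' x‖ ^ 2 * W x := by
    have hS : 0 < κ ^ 2 * (∫ x in K, f x ^ 2 * W x) - ∫ x in K, ‖f' x‖ ^ 2 * W x := by linarith
    refine ⟨(κ ^ 2 * (∫ x in K, f x ^ 2 * W x) - ∫ x in K, ‖f' x‖ ^ 2 * W x) / ((∫ x in K, W x) + 1), by positivity, ?_⟩
    rw [div_mul_eq_mul_div, div_lt_iff₀ (by linarith)]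
    nlinarith
  obtain ⟨ε, hε, hεc⟩ : ∃ ε > 0, ε + κ ^ 2 * ε + κ ^ 2 * ε ^ 2 ≤ c := by
    have : Tendsto (fun ε : ℝ => ε + κ ^ 2 * ε + κ ^ 2 * ε ^ 2) (𝓝[>] 0) (𝓝 0) := by
      have : Continuous (fun ε : ℝ => ε + κ ^ 2 * ε + κ ^ 2 * ε ^ 2) := by fun_prop
      have h := this.tendsto 0
      simp only [mul_zero, add_zero, ne_eq, OfNat.ofNat_ne_zero, not_false_eq_true, zero_pow] at h
      exact h.mono_left nhdsWithin_le_nhds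
    obtain ⟨ε, h1, h2⟩ := ((this.eventually_le_const hc).and self_mem_nhdsWithin).exists
    exact ⟨ε, h2, h1⟩
  have int_k : ∀ L ⊆ K, ∫ x in L, (κ ^ 2 * (f x ^ 2 * W x) - ‖f' x‖ ^ 2 * W x - c * W x) =
      κ ^ 2 * (∫ x in L, f x ^ 2 * W x) - (∫ x in L, ‖f' x‖ ^ 2 * W x) - c * ∫ x in L, W x := by
    intro L hL
    rw [integral_sub, integral_sub, integral_const_mul, integral_const_mul]
    · exact (iA.mono_set hL).const_mul _
    · exact iB.mono_set hL
    · exact ((iA.mono_set hL).const_mul _).sub (iB.mono_set hL)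
    · exact (iW.mono_set hL).const_mul _
  obtain ⟨δ, hδ, hU⟩ : ∃ δ > 0, ∀ x ∈ K, ∀ y, dist x y < δ → y ∈ Ω ∧ |f x - f y| ≤ ε ∧ |f x ^ 2 - f y ^ 2| ≤ ε ∧ |‖f' x‖ ^ 2 - ‖f' y‖ ^ 2| ≤ ε := by
    obtain ⟨δ1, hδ1, hs⟩ := hK.exists_thickening_subset_open ho hKΩ
    have gen : ∀ F : EuclideanSpace ℝ (Fin (k + 1)) → ℝ, ContinuousOn F Ω → ∃ δ > 0, ∀ x ∈ K, ∀ y, dist x y < δ → |F x - F y| ≤ ε := by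
      intro F hF
      have := hK.uniformContinuousAt_of_continuousAt F (fun x hx => hF.continuousAt (ho.mem_nhds (hKΩ hx))) (Metric.dist_mem_uniformity hε)
      obtain ⟨δ, hδ, h⟩ := Metric.mem_uniformity_dist.1 this
      exact ⟨δ, hδ, fun x hx y hxy => le_of_lt (h hxy hx)⟩
    obtain ⟨δ2, hδ2, h2⟩ := gen f hf
    obtain ⟨δ3, hδ3, h3⟩ := gen (fun x => f x ^ 2) (hf.pow 2)
    obtain ⟨δ4, hδ4, h4⟩ := gen (fun x => ‖f' x‖ ^ 2) (hf'.norm.pow 2)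
    refine ⟨min (min δ1 δ2) (min δ3 δ4), by positivity, fun x hx y hxy => ?_⟩
    simp only [lt_min_iff] at hxy
    exact ⟨hs (Metric.mem_thickening_iff.2 ⟨x, hx, by rw [dist_comm]; exact hxy.1.1⟩), h2 x hx y hxy.1.2, h3 x hx y hxy.2.1, h4 x hx y hxy.2.2⟩
  have iK : IntegrableOn (fun x => κ ^ 2 * (f x ^ 2 * W x) - ‖f' x‖ ^ 2 * W x - c * W x) K :=
    ((iA.const_mul (κ ^ 2)).sub iB).sub (iW.const_mul c)
  obtain ⟨L, a, v, hLk, hLc, hLK, hL0, hL1, hv, hav⟩ := localization (Nat.succ_pos k) K hK hKc (fun x => f x * W x)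
    (fun x => κ ^ 2 * (f x ^ 2 * W x) - ‖f' x‖ ^ 2 * W x - c * W x) iF iK h0
    (by rw [int_k K subset_rfl]; linarith) δ hδ
  have hvol : volume L ≠ 0 := by
    intro h
    rw [Measure.restrict_eq_zero.2 h] at hL1
    simp at hL1
  have := needle_step L hLk hLc hvol Ω (hLK.trans hKΩ) W f f' hW hW0 (fun x hx y hy => hlc x (hLK hx) y (hLK hy)) hf hf' hfd hκ
    (fun x hx y hy => hκb x (hLK hx) y (hLK hy)) hL0 δ ε (fun x hx => hU x (hLK hx)) a v hv hav
  rw [int_k L hLK] at hL1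
  have hM : 0 ≤ ∫ x in L, W x := setIntegral_nonneg hLk.measurableSet fun x hx => (hW0 x (hKΩ (hLK hx))).le
  nlinarith

lemma compact_gen {k : ℕ} (K : Set (EuclideanSpace ℝ (Fin (k + 1)))) (hK : IsCompact K) (hKc : Convex ℝ K)
    (Ω : Set (EuclideanSpace ℝ (Fin (k + 1)))) (ho : IsOpen Ω) (hKΩ : K ⊆ Ω)
    (W f : EuclideanSpace ℝ (Fin (k + 1)) → ℝ) (f' : EuclideanSpace ℝ (Fin (k + 1)) → EuclideanSpace ℝ (Fin (k + 1)))
    (hW : ContinuousOn W Ω) (hW0 : ∀ x ∈ Ω, 0 < W x)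
    (hlc : ∀ x ∈ K, ∀ y ∈ K, ∀ s : ℝ, 0 < s → s < 1 → W x ^ (1 - s) * W y ^ s ≤ W ((1 - s) • x + s • y))
    (hf : ContinuousOn f Ω) (hf' : ContinuousOn f' Ω) (hfd : ∀ x ∈ Ω, HasGradientAt f (f' x) x)
    {κ : ℝ} (hκ : 0 < κ) (hκb : ∀ x ∈ K, ∀ y ∈ K, κ * dist x y ≤ Real.pi)
    (hM : 0 < ∫ x in K, W x) :
    κ ^ 2 * ((∫ x in K, f x ^ 2 * W x) - (∫ x in K, f x * W x) ^ 2 / ∫ x in K, W x) ≤ ∫ x in K, ‖f' x‖ ^ 2 * W x := by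
  have hWK := hW.mono hKΩ
  have hfK := hf.mono hKΩ
  have iW : IntegrableOn W K := hWK.integrableOn_compact hK
  have iA : IntegrableOn (fun x => f x ^ 2 * W x) K := ((hfK.pow 2).mul hWK).integrableOn_compact hK
  have iF : IntegrableOn (fun x => f x * W x) K := (hfK.mul hWK).integrableOn_compact hK
  set m := (∫ x in K, f x * W x) / ∫ x in K, W x with hm
  have hmM : m * (∫ x in K, W x) = ∫ x in K, f x * W x := div_mul_cancel₀ _ hM.ne'
  have := compact_zero K hK hKc Ω ho hKΩ W (fun x => f x - m) f' hW hW0 hlc (hf.sub continuousOn_const) hf'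
    (fun x hx => by
      have h := (hfd x hx).hasFDerivAt.sub_const m
      exact h) hκ hκb (by
      have : ∀ x, (f x - m) * W x = f x * W x - m * W x := fun x => by ring
      simp_rw [this]
      rw [integral_sub iF (iW.const_mul m), integral_const_mul, hmM, sub_self])
  refine le_trans (le_of_eq ?_) this
  congr 1
  have : ∀ x, (f x - m) ^ 2 * W x = f x ^ 2 * W x - 2 * m * (f x * W x) + m ^ 2 * W x := fun x => by ring
  simp_rw [this]
  have i1 : IntegrableOn (fun x => f x ^ 2 * W x - 2 * m * (f x * W x)) K := iA.sub (iF.const_mul _)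
  rw [integral_add i1 (iW.const_mul _), integral_sub iA (iF.const_mul _), integral_const_mul, integral_const_mul, ← hmM]
  field_simp
  ring

lemma exhaustion {n : ℕ} (Ω : Set (EuclideanSpace ℝ (Fin n))) (hne : Ω.Nonempty) (ho : IsOpen Ω)
    (hconv : Convex ℝ Ω) (hbdd : Bornology.IsBounded Ω) :
    ∃ K : ℕ → Set (EuclideanSpace ℝ (Fin n)), Monotone K ∧ (∀ i, IsCompact (K i) ∧ Convex ℝ (K i) ∧ K i ⊆ Ω ∧ 0 < volume (K i)) ∧
      ⋃ i, K i = Ω := by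
  obtain ⟨x0, hx0⟩ := hne
  let T : ℝ → EuclideanSpace ℝ (Fin n) → EuclideanSpace ℝ (Fin n) := fun r y => (1 - r) • x0 + r • y
  have hTi : ∀ r : ℝ, r ≠ 0 → ∀ x, T r (T r⁻¹ x) = x := by
    intro r hr x
    simp only [T, smul_add, smul_smul, mul_inv_cancel₀ hr, one_smul, ← add_assoc, ← add_smul]
    have : 1 - r + r * (1 - r⁻¹) = 0 := by field_simp; ring
    rw [this, zero_smul, zero_add]
  have hTT : ∀ r s : ℝ, ∀ x, T r (T s x) = T (r * s) x := by
    intro r s x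
    simp only [T, smul_add, smul_smul, ← add_assoc, ← add_smul]
    congr 2
    ring
  have hcc := hconv.closure
  have hTcl : ∀ r : ℝ, 0 ≤ r → r ≤ 1 → ∀ y ∈ closure Ω, T r y ∈ closure Ω := by
    intro r h0 h1 y hy
    exact hcc (subset_closure hx0) hy (by linarith) h0 (by ring)
  let r : ℕ → ℝ := fun i => 1 - 1 / ((i : ℝ) + 2)
  have hr0 : ∀ i, 0 < r i := by
    intro i
    have : 1 / ((i : ℝ) + 2) < 1 := by
      rw [div_lt_one (by positivity)]; linarith [(Nat.cast_nonneg i : (0 : ℝ) ≤ i)]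
    simp only [r]; linarith
  have hr1 : ∀ i, r i < 1 := by
    intro i
    have : 0 < 1 / ((i : ℝ) + 2) := by positivity
    simp only [r]; linarith
  have hrm : Monotone r := by
    intro i j hij
    have : (i : ℝ) ≤ j := by exact_mod_cast hij
    simp only [r]
    gcongr
  have hrt : Tendsto r atTop (𝓝 1) := by
    have h : Tendsto (fun i : ℕ => 1 / ((i : ℝ) + 2)) atTop (𝓝 0) := by
      simp_rw [one_div]
      exact tendsto_inv_atTop_zero.comp (tendsto_atTop_add_const_right _ _ tendsto_natCast_atTop_atTop)
    simpa [r] using h.const_sub 1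
  refine ⟨fun i => T (r i) '' closure Ω, ?_, ?_, ?_⟩
  · rintro i j hij _ ⟨y, hy, rfl⟩
    refine ⟨T (r i / r j) y, hTcl _ (div_nonneg (hr0 i).le (hr0 j).le) ((div_le_one (hr0 j)).2 (hrm hij)) y hy, ?_⟩
    rw [hTT, mul_div_cancel₀ _ (hr0 j).ne']
  · intro i
    refine ⟨hbdd.isCompact_closure.image (by fun_prop), hcc.affinity _ _, ?_, ?_⟩
    · rintro _ ⟨y, hy, rfl⟩
      have := hconv.combo_interior_closure_mem_interior (x := x0) (by rwa [ho.interior_eq]) hy (sub_pos.2 (hr1 i)) (hr0 i).le (by ring)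
      rwa [ho.interior_eq] at this
    · have hop : IsOpen (T (r i)⁻¹ ⁻¹' Ω) := ho.preimage (by fun_prop)
      refine (hop.measure_pos volume ⟨x0, ?_⟩).trans_le (measure_mono ?_)
      · have : T (r i)⁻¹ x0 = x0 := by simp only [T, ← add_smul]; simp
        rw [mem_preimage, this]; exact hx0
      · intro x hx
        exact ⟨T (r i)⁻¹ x, subset_closure hx, hTi _ (hr0 i).ne' x⟩
  · apply Subset.antisymm
    · apply iUnion_subset
      rintro i _ ⟨y, hy, rfl⟩
      have := hconv.combo_interior_closure_mem_interior (x := x0) (by rwa [ho.interior_eq]) hy (sub_pos.2 (hr1 i)) (hr0 i).le (by ring)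
      rwa [ho.interior_eq] at this
    · intro x hx
      have ht : Tendsto (fun i => T (r i)⁻¹ x) atTop (𝓝 x) := by
        have h1 : Tendsto (fun i => (r i)⁻¹) atTop (𝓝 1) := by simpa using hrt.inv₀ one_ne_zero
        have h2 : Continuous fun s => T s x := by fun_prop
        have h3 := (h2.tendsto 1).comp h1
        have : T 1 x = x := by simp [T]
        rwa [this] at h3
      obtain ⟨i, hi⟩ := (ht.eventually (ho.mem_nhds hx)).exists
      exact mem_iUnion.2 ⟨i, T (r i)⁻¹ x, subset_closure hi, hTi _ (hr0 i).ne' x⟩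

lemma main_aux {k : ℕ}
    (Ω : Set (EuclideanSpace ℝ (Fin (k + 1)))) (hne : Ω.Nonempty) (ho : IsOpen Ω)
    (hconv : Convex ℝ Ω) (hbdd : Bornology.IsBounded Ω)
    (ρ : EuclideanSpace ℝ (Fin (k + 1)) → ℝ) (hρ : ContinuousOn ρ Ω)
    (hρconv : ConvexOn ℝ Ω ρ)
    (μ : Measure (EuclideanSpace ℝ (Fin (k + 1))))
    (hμ : μ = (volume.restrict Ω).withDensity fun x => ENNReal.ofReal (Real.exp (-ρ x)))
    (f : EuclideanSpace ℝ (Fin (k + 1)) → ℝ) (hf : ContDiffOn ℝ 1 f Ω)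
    (hf1 : Integrable f μ) (hf2 : Integrable (fun x => f x ^ 2) μ)
    (hf0 : ∫ x, f x ∂μ = 0) :
    ENNReal.ofReal (Real.pi ^ 2 / Metric.diam Ω ^ 2 * ∫ x, f x ^ 2 ∂μ) ≤
      ∫⁻ x, ENNReal.ofReal (‖gradient f x‖ ^ 2) ∂μ := by
  by_cases hD : Metric.diam Ω = 0
  · simp [hD]
  have hD' : 0 < Metric.diam Ω := lt_of_le_of_ne Metric.diam_nonneg (Ne.symm hD)
  obtain ⟨K, hKm, hK, hKU⟩ := exhaustion Ω hne ho hconv hbdd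
  let W : EuclideanSpace ℝ (Fin (k + 1)) → ℝ := fun x => Real.exp (-ρ x)
  have hW : ContinuousOn W Ω := hρ.neg.rexp
  have hW0 : ∀ x ∈ Ω, 0 < W x := fun x _ => Real.exp_pos _
  have hWK : ∀ i, ContinuousOn W (K i) := fun i => hW.mono (hK i).2.2.1
  have mK : ∀ i, MeasurableSet (K i) := fun i => (hK i).1.measurableSet
  have iW : ∀ i, IntegrableOn W (K i) := fun i => (hWK i).integrableOn_compact (hK i).1
  have aW : ∀ i, AEMeasurable (fun x => ENNReal.ofReal (W x)) (volume.restrict (K i)) := fun i =>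
    ((hWK i).aemeasurable (mK i)).ennreal_ofReal
  have hres : ∀ i, μ.restrict (K i) = (volume.restrict (K i)).withDensity fun x => ENNReal.ofReal (W x) := by
    intro i
    rw [hμ, restrict_withDensity (mK i), Measure.restrict_restrict (mK i), inter_eq_left.2 (hK i).2.2.1]
  have hint : ∀ i (F : EuclideanSpace ℝ (Fin (k + 1)) → ℝ), ∫ x in K i, F x ∂μ = ∫ x in K i, F x * W x := by
    intro i F
    rw [hres, integral_withDensity_eq_integral_toReal_smul₀ (aW i) (Eventually.of_forall fun x => ENNReal.ofReal_lt_top)]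
    congr 1
    ext x
    rw [ENNReal.toReal_ofReal (Real.exp_pos _).le, smul_eq_mul, mul_comm]
  have hM : ∀ i, 0 < ∫ x in K i, W x := by
    intro i
    rw [setIntegral_pos_iff_support_of_nonneg_ae _ (iW i)]
    · have : Function.support W ∩ K i = K i := inter_eq_right.2 fun x hx => (Real.exp_pos _).ne'
      rw [this]; exact (hK i).2.2.2
    · exact Eventually.of_forall fun x => (Real.exp_pos _).le
  have hMm : ∀ i, ∫ x in K 0, W x ≤ ∫ x in K i, W x := fun i =>
    setIntegral_mono_set (iW i) (Eventually.of_forall fun x => (Real.exp_pos _).le) (hKm (Nat.zero_le i)).eventuallyLE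
  have hfd : ∀ x ∈ Ω, HasGradientAt f (gradient f x) x := fun x hx =>
    ((hf.differentiableOn one_ne_zero).differentiableAt (ho.mem_nhds hx)).hasGradientAt
  have hf' : ContinuousOn (gradient f) Ω :=
    (LinearIsometryEquiv.continuous _).comp_continuousOn (hf.continuousOn_fderiv_of_isOpen ho le_rfl)
  set κ := Real.pi / Metric.diam Ω with hκ
  have hκ0 : 0 < κ := div_pos Real.pi_pos hD'
  have hlc : ∀ x ∈ Ω, ∀ y ∈ Ω, ∀ s : ℝ, 0 < s → s < 1 → W x ^ (1 - s) * W y ^ s ≤ W ((1 - s) • x + s • y) := by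
    intro x hx y hy s hs hs1
    simp only [W]
    rw [← Real.exp_mul, ← Real.exp_mul, ← Real.exp_add, Real.exp_le_exp]
    have := hρconv.2 hx hy (sub_nonneg.2 hs1.le) hs.le (by ring)
    simp only [smul_eq_mul] at this
    linarith
  have key : ∀ i, ENNReal.ofReal (κ ^ 2 * ((∫ x in K i, f x ^ 2 ∂μ) - (∫ x in K i, f x ∂μ) ^ 2 / ∫ x in K i, W x)) ≤
      ∫⁻ x, ENNReal.ofReal (‖gradient f x‖ ^ 2) ∂μ := by
    intro i
    have h := compact_gen (K i) (hK i).1 (hK i).2.1 Ω ho (hK i).2.2.1 W f (gradient f) hW hW0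
      (fun x hx y hy => hlc x ((hK i).2.2.1 hx) y ((hK i).2.2.1 hy)) hf.continuousOn hf' hfd hκ0
      (fun x hx y hy => by
        have := Metric.dist_le_diam_of_mem hbdd ((hK i).2.2.1 hx) ((hK i).2.2.1 hy)
        rw [hκ, div_mul_eq_mul_div, div_le_iff₀ hD']
        exact mul_le_mul_of_nonneg_left this Real.pi_pos.le) (hM i)
    rw [hint, hint]
    refine (ENNReal.ofReal_le_ofReal h).trans ?_
    refine le_trans (le_of_eq ?_) (setLIntegral_le_lintegral (K i) _)
    rw [hres, lintegral_withDensity_eq_lintegral_mul_non_measurable₀ _ (aW i) (Eventually.of_forall fun x => ENNReal.ofReal_lt_top),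
      ofReal_integral_eq_lintegral_ofReal]
    · apply lintegral_congr
      intro x
      rw [Pi.mul_apply, mul_comm, ENNReal.ofReal_mul (Real.exp_pos _).le]
    · exact (((hf'.mono (hK i).2.2.1).norm.pow 2).mul (hWK i)).integrableOn_compact (hK i).1
    · exact Eventually.of_forall fun x => mul_nonneg (sq_nonneg _) (Real.exp_pos _).le
  have hμΩ : μ.restrict Ω = μ := by
    rw [hμ, restrict_withDensity ho.measurableSet, Measure.restrict_restrict ho.measurableSet, inter_self]
  have t1 : Tendsto (fun i => ∫ x in K i, f x ∂μ) atTop (𝓝 0) := by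
    have := tendsto_setIntegral_of_monotone mK hKm (f := f) (μ := μ) hf1.integrableOn
    rwa [hKU, hμΩ, hf0] at this
  have t2 : Tendsto (fun i => ∫ x in K i, f x ^ 2 ∂μ) atTop (𝓝 (∫ x, f x ^ 2 ∂μ)) := by
    have := tendsto_setIntegral_of_monotone mK hKm (f := fun x => f x ^ 2) (μ := μ) hf2.integrableOn
    rwa [hKU, hμΩ] at this
  have t3 : Tendsto (fun i => (∫ x in K i, f x ∂μ) ^ 2 / ∫ x in K i, W x) atTop (𝓝 0) := by
    have h : Tendsto (fun i => (∫ x in K i, f x ∂μ) ^ 2 / ∫ x in K 0, W x) atTop (𝓝 0) := by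
      simpa using (t1.pow 2).div_const (∫ x in K 0, W x)
    refine squeeze_zero (fun i => div_nonneg (sq_nonneg _) (hM i).le) (fun i => ?_) h
    exact div_le_div_of_nonneg_left (sq_nonneg _) (hM 0) (hMm i)
  have t4 := ENNReal.tendsto_ofReal ((t2.sub t3).const_mul (κ ^ 2))
  rw [sub_zero] at t4
  rw [← div_pow]
  exact le_of_tendsto t4 (Eventually.of_forall key)

end
end PW

/-- **Payne–Weinberger / Yang–Zhong Poincaré inequality** for a bounded open convex set
`Ω ⊆ ℝⁿ` of diameter `D` with log-concave weight `e^{-ρ}` (`ρ` smooth and convex): every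
`C¹` function `f ∈ L¹(μ) ∩ L²(μ)` with `∫ f dμ = 0` satisfies
`(π²/D²) ∫ f² dμ ≤ ∫ ‖∇f‖² dμ`. -/
theorem payne_weinberger {n : ℕ} (hn : 2 ≤ n)
    (Ω : Set (EuclideanSpace ℝ (Fin n))) (hne : Ω.Nonempty) (ho : IsOpen Ω)
    (hconv : Convex ℝ Ω) (hbdd : Bornology.IsBounded Ω)
    (ρ : EuclideanSpace ℝ (Fin n) → ℝ) (hρ : ContDiffOn ℝ (⊤ : ℕ∞) ρ Ω)
    (hρconv : ConvexOn ℝ Ω ρ)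
    (μ : Measure (EuclideanSpace ℝ (Fin n)))
    (hμ : μ = (volume.restrict Ω).withDensity fun x => ENNReal.ofReal (Real.exp (-ρ x)))
    (f : EuclideanSpace ℝ (Fin n) → ℝ) (hf : ContDiffOn ℝ 1 f Ω)
    (hf1 : Integrable f μ) (hf2 : Integrable (fun x => f x ^ 2) μ)
    (hf0 : ∫ x, f x ∂μ = 0) :
    ENNReal.ofReal (Real.pi ^ 2 / Metric.diam Ω ^ 2 * ∫ x, f x ^ 2 ∂μ) ≤
      ∫⁻ x, ENNReal.ofReal (‖gradient f x‖ ^ 2) ∂μ := by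
  obtain ⟨k, rfl⟩ : ∃ k, n = k + 1 := ⟨n - 1, by omega⟩
  exact PW.main_aux Ω hne ho hconv hbdd ρ hρ.continuousOn hρconv μ hμ f hf hf1 hf2 hf0
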